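/- Let d ≥ 1, γ ≥ 0 and for an integer M ≥ 1 define C_{q,p}(M) = sup over nonzero finitely supported sequences (c_n)_{n∈ℤ^d} with c_n = 0 for |n| > M of ‖ Σ_{|n|≤M} c_n e^{2πi⟨x,n⟩} ‖_{L^q([0,1]^d)} / ( Σ_{|n|≤M} |c_n|^p (1+|n|)^{pγ} )^{1/p}. Then, with implied constants independent of M: (i) for 1 ≤ p ≤ q < ∞, C_{q,p}(M) ≈ M^{−γ + d(1 − 1/p − 1/q)} if γ < d(1 − 1/p − 1/q), and C_{q,p}(M) ≈ 1 if γ ≥ d(1 − 1/p − 1/q); (ii) for 1 ≤ p ≤ q = ∞, C_{∞,p}(M) ≈ M^{−γ + d(1 − 1/p)} if γ < d(1 − 1/p), ≈ (log(M+1))^{1 − 1/p} if γ = d(1 − 1/p), and ≈ 1 if γ > d(1 − 1/p). -/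

import Mathlib

open MeasureTheory
open scoped ENNReal Real

/-- Euclidean norm of an integer lattice point `n ∈ ℤ^d`. -/
noncomputable def zNorm {d : ℕ} (n : Fin d → ℤ) : ℝ :=
  Real.sqrt (∑ i, ((n i : ℝ)) ^ 2)

/-- The trigonometric polynomial `Σ_n c_n e^{2πi⟨x,n⟩}` associated with a finitely
supported sequence of real coefficients. -/
noncomputable def trigPoly {d : ℕ} (c : (Fin d → ℤ) → ℝ) (x : Fin d → ℝ) : ℂ :=
  ∑ᶠ n : Fin d → ℤ, (c n : ℂ) *
    Complex.exp (2 * (π : ℂ) * Complex.I * (∑ i, (x i : ℂ) * (n i : ℂ)))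

/-- The best constant `C_{q,p}(M)` in the local uncertainty inequality for
trigonometric polynomials with frequencies `|n| ≤ M` and weight `(1+|n|)^γ`. -/
noncomputable def trigConst (d : ℕ) (γ : ℝ) (q p : ℝ≥0∞) (M : ℕ) : ℝ≥0∞ :=
  ⨆ c : {c : (Fin d → ℤ) → ℝ // c ≠ 0 ∧ (Function.support c).Finite ∧
      ∀ n, (M : ℝ) < zNorm n → c n = 0},
    eLpNorm (trigPoly c.1) q
        (volume.restrict (Set.univ.pi fun _ : Fin d => Set.Icc (0:ℝ) 1)) /
      eLpNorm (fun n => c.1 n * (1 + zNorm n) ^ γ) p Measure.count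

/-- Two-sided comparison `c·g ≤ X ≤ C·g`. -/
def Approx (X : ℝ≥0∞) (c C g : ℝ) : Prop :=
  ENNReal.ofReal (c * g) ≤ X ∧ X ≤ ENNReal.ofReal (C * g)


/-! ### Power sums over lattice points -/

/-- The weight `1 + |n|`. -/
noncomputable def latticeWeight {d : ℕ} (n : Fin d → ℤ) : ℝ := 1 + zNorm n

lemma zNorm_nonneg {d : ℕ} (n : Fin d → ℤ) : 0 ≤ zNorm n := Real.sqrt_nonneg _

lemma one_le_latticeWeight {d : ℕ} (n : Fin d → ℤ) : 1 ≤ latticeWeight n := by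
  have := zNorm_nonneg n
  unfold latticeWeight
  linarith

lemma latticeWeight_pos {d : ℕ} (n : Fin d → ℤ) : 0 < latticeWeight n :=
  zero_lt_one.trans_le (one_le_latticeWeight n)

lemma latticeWeight_rpow_pos {d : ℕ} (n : Fin d → ℤ) (s : ℝ) : 0 < latticeWeight n ^ s :=
  Real.rpow_pos_of_pos (latticeWeight_pos n) s

lemma abs_le_zNorm {d : ℕ} (n : Fin d → ℤ) (i : Fin d) : |(n i : ℝ)| ≤ zNorm n :=
  Real.abs_le_sqrt
    (Finset.single_le_sum (f := fun j => (n j : ℝ) ^ 2) (fun _ _ => sq_nonneg _)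
      (Finset.mem_univ i))

lemma card_le_of_zNorm_le {d : ℕ} {R : ℝ} (hR : 1 ≤ R) (S : Finset (Fin d → ℤ))
    (hS : ∀ n ∈ S, zNorm n ≤ R) : (S.card : ℝ) ≤ 3 ^ d * R ^ d := by
  have hfl : 0 ≤ ⌊R⌋ := Int.floor_nonneg.2 (by linarith)
  have hsub : S ⊆ Fintype.piFinset fun _ : Fin d => Finset.Icc (-⌊R⌋) ⌊R⌋ := by
    intro n hn
    rw [Fintype.mem_piFinset]
    intro i
    rw [Finset.mem_Icc, ← abs_le]
    apply Int.le_floor.2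
    push_cast
    exact (abs_le_zNorm n i).trans (hS n hn)
  have hcard := Finset.card_le_card hsub
  rw [Fintype.card_piFinset_const, Int.card_Icc] at hcard
  calc (S.card : ℝ) ≤ (((⌊R⌋ + 1 - -⌊R⌋).toNat ^ d : ℕ) : ℝ) := by exact_mod_cast hcard
    _ = ((⌊R⌋ + 1 - -⌊R⌋ : ℤ) : ℝ) ^ d := by
        rw [Nat.cast_pow]
        congr 1
        exact_mod_cast Int.toNat_of_nonneg (by omega)
    _ ≤ (3 * R) ^ d := by
        apply pow_le_pow_left₀
        · exact_mod_cast (by omega : 0 ≤ ⌊R⌋ + 1 - -⌊R⌋)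
        · have := Int.floor_le R
          push_cast
          linarith
    _ = 3 ^ d * R ^ d := mul_pow _ _ _

/-- The index of the dyadic shell `2 ^ j ≤ 1 + |n| < 2 ^ (j + 1)` containing `n`. -/
noncomputable def dyadicScale {d : ℕ} (n : Fin d → ℤ) : ℕ := Nat.log 2 ⌊latticeWeight n⌋₊

lemma two_pow_log_floor_le {R : ℝ} (hR : 1 ≤ R) : (2 : ℝ) ^ Nat.log 2 ⌊R⌋₊ ≤ R := by
  have h1 : ⌊R⌋₊ ≠ 0 := (Nat.floor_pos.2 hR).ne'
  calc (2 : ℝ) ^ Nat.log 2 ⌊R⌋₊ ≤ (⌊R⌋₊ : ℝ) := by exact_mod_cast Nat.pow_log_le_self 2 h1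
    _ ≤ R := Nat.floor_le (by linarith)

lemma lt_two_pow_log_floor_succ {R : ℝ} (hR : 1 ≤ R) :
    R < (2 : ℝ) ^ (Nat.log 2 ⌊R⌋₊ + 1) := by
  have h := Nat.lt_pow_succ_log_self (b := 2) (by norm_num) ⌊R⌋₊
  rw [Nat.floor_lt (by linarith)] at h
  exact_mod_cast h

lemma dyadicScale_le {d : ℕ} {n : Fin d → ℤ} {R : ℝ} (h : latticeWeight n ≤ R) :
    dyadicScale n ≤ Nat.log 2 ⌊R⌋₊ :=
  Nat.log_mono_right (Nat.floor_le_floor h)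

lemma le_dyadicScale {d : ℕ} {n : Fin d → ℤ} {R : ℝ} (h : R ≤ latticeWeight n) :
    Nat.log 2 ⌊R⌋₊ ≤ dyadicScale n :=
  Nat.log_mono_right (Nat.floor_le_floor h)

lemma sum_rpow_le_of_dyadicScale_eq {d : ℕ} {s : ℝ} (hs : 0 ≤ s) (j : ℕ)
    (S : Finset (Fin d → ℤ)) (hS : ∀ n ∈ S, dyadicScale n = j) :
    ∑ n ∈ S, latticeWeight n ^ (-s) ≤ 6 ^ d * ((2 : ℝ) ^ ((d : ℝ) - s)) ^ j := by
  have hcard : (S.card : ℝ) ≤ 3 ^ d * (2 ^ (j + 1)) ^ d := by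
    apply card_le_of_zNorm_le (one_le_pow₀ (by norm_num))
    intro n hn
    have h := lt_two_pow_log_floor_succ (one_le_latticeWeight n)
    rw [← dyadicScale, hS n hn, latticeWeight] at h
    linarith
  have hterm : ∀ n ∈ S, latticeWeight n ^ (-s) ≤ ((2 : ℝ) ^ j) ^ (-s) := by
    intro n hn
    have h := two_pow_log_floor_le (one_le_latticeWeight n)
    rw [← dyadicScale, hS n hn] at h
    exact Real.rpow_le_rpow_of_nonpos (by positivity) h (by linarith)
  calc ∑ n ∈ S, latticeWeight n ^ (-s) ≤ S.card • ((2 : ℝ) ^ j) ^ (-s) :=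
        Finset.sum_le_card_nsmul _ _ _ hterm
    _ = S.card * ((2 : ℝ) ^ j) ^ (-s) := nsmul_eq_mul _ _
    _ ≤ 3 ^ d * (2 ^ (j + 1)) ^ d * ((2 : ℝ) ^ j) ^ (-s) := by gcongr
    _ = 6 ^ d * ((2 : ℝ) ^ ((d : ℝ) - s)) ^ j := by
        have h1 : ((2 : ℝ) ^ ((d : ℝ) - s)) ^ j = ((2 : ℝ) ^ j) ^ d * ((2 : ℝ) ^ j) ^ (-s) := by
          rw [← Real.rpow_natCast, ← Real.rpow_natCast, ← Real.rpow_natCast, ← Real.rpow_mul,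
            ← Real.rpow_mul, ← Real.rpow_mul, ← Real.rpow_add] <;> try norm_num
          ring_nf
        rw [h1, pow_succ, mul_pow, show (6 : ℝ) = 3 * 2 by norm_num, mul_pow]
        ring

lemma sum_rpow_le_sum_geometric {d : ℕ} {s : ℝ} (hs : 0 ≤ s) (a b : ℕ)
    (S : Finset (Fin d → ℤ)) (hS : ∀ n ∈ S, a ≤ dyadicScale n ∧ dyadicScale n < b) :
    ∑ n ∈ S, latticeWeight n ^ (-s) ≤
      6 ^ d * ∑ j ∈ Finset.Ico a b, ((2 : ℝ) ^ ((d : ℝ) - s)) ^ j := by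
  rw [← Finset.sum_fiberwise_of_maps_to (t := Finset.Ico a b) (g := dyadicScale)
    (fun n hn => Finset.mem_Ico.2 (hS n hn)), Finset.mul_sum]
  apply Finset.sum_le_sum
  intro j _
  apply sum_rpow_le_of_dyadicScale_eq hs
  intro n hn
  exact (Finset.mem_filter.1 hn).2

lemma exists_sum_rpow_low_le {d : ℕ} {s : ℝ} (hs : 0 ≤ s) (hsd : s < d) :
    ∃ A : ℝ, 0 < A ∧ ∀ R : ℝ, 0 < R → ∀ S : Finset (Fin d → ℤ),
      (∀ n ∈ S, latticeWeight n ≤ R) →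
        ∑ n ∈ S, latticeWeight n ^ (-s) ≤ A * R ^ ((d : ℝ) - s) := by
  set x : ℝ := (2 : ℝ) ^ ((d : ℝ) - s) with hx
  have hx1 : 1 < x := Real.one_lt_rpow (by norm_num) (by linarith)
  have hx2 : 0 < x - 1 := by linarith
  refine ⟨6 ^ d * (x / (x - 1)), by positivity, fun R hR S hS => ?_⟩
  rcases S.eq_empty_or_nonempty with rfl | ⟨m, hm⟩
  · simp only [Finset.sum_empty]
    positivity
  have hR1 : 1 ≤ R := (one_le_latticeWeight m).trans (hS m hm)
  set J := Nat.log 2 ⌊R⌋₊ with hJ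
  have h := sum_rpow_le_sum_geometric hs 0 (J + 1) S fun n hn =>
    ⟨Nat.zero_le _, Nat.lt_succ_of_le (dyadicScale_le (hS n hn))⟩
  refine h.trans ?_
  rw [mul_assoc]
  gcongr
  rw [← hx, ← Finset.range_eq_Ico, geom_sum_eq hx1.ne', div_mul_eq_mul_div]
  gcongr
  have hxJ : x ^ J ≤ R ^ ((d : ℝ) - s) := by
    have h2 := two_pow_log_floor_le hR1
    rw [← hJ] at h2
    calc x ^ J = ((2 : ℝ) ^ J) ^ ((d : ℝ) - s) := by
          rw [hx, ← Real.rpow_natCast, ← Real.rpow_natCast, ← Real.rpow_mul (by norm_num),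
            ← Real.rpow_mul (by norm_num), mul_comm]
      _ ≤ _ := Real.rpow_le_rpow (by positivity) h2 (by linarith)
  calc x ^ (J + 1) - 1 ≤ x * x ^ J := by rw [pow_succ]; linarith
    _ ≤ _ := by gcongr

lemma exists_sum_rpow_tail_le {d : ℕ} {s : ℝ} (hsd : (d : ℝ) < s) :
    ∃ A : ℝ, 0 < A ∧ ∀ R : ℝ, 1 ≤ R → ∀ S : Finset (Fin d → ℤ),
      (∀ n ∈ S, R ≤ latticeWeight n) →
        ∑ n ∈ S, latticeWeight n ^ (-s) ≤ A * R ^ ((d : ℝ) - s) := by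
  have hs : 0 ≤ s := (Nat.cast_nonneg d).trans hsd.le
  set x : ℝ := (2 : ℝ) ^ ((d : ℝ) - s) with hx
  have hx0 : 0 < x := Real.rpow_pos_of_pos (by norm_num) _
  have hx1 : x < 1 := Real.rpow_lt_one_of_one_lt_of_neg (by norm_num) (by linarith)
  have hx2 : 0 < 1 - x := by linarith
  refine ⟨6 ^ d * ((1 / 2) ^ ((d : ℝ) - s) / (1 - x)), by positivity, fun R hR S hS => ?_⟩
  set J := Nat.log 2 ⌊R⌋₊ with hJ
  have h := sum_rpow_le_sum_geometric hs J (S.sup dyadicScale + 1) S fun n hn =>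
    ⟨le_dyadicScale (hS n hn), Nat.lt_succ_of_le (Finset.le_sup (f := dyadicScale) hn)⟩
  refine h.trans ?_
  rw [mul_assoc]
  gcongr
  rw [← hx]
  refine (geom_sum_Ico_le_of_lt_one hx0.le hx1).trans ?_
  rw [div_mul_eq_mul_div]
  gcongr
  have h2 := lt_two_pow_log_floor_succ hR
  rw [← hJ, pow_succ] at h2
  calc x ^ J = ((2 : ℝ) ^ J) ^ ((d : ℝ) - s) := by
        rw [hx, ← Real.rpow_natCast, ← Real.rpow_natCast, ← Real.rpow_mul (by norm_num),
          ← Real.rpow_mul (by norm_num), mul_comm]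
    _ ≤ (1 / 2 * R) ^ ((d : ℝ) - s) :=
        Real.rpow_le_rpow_of_nonpos (by positivity) (by linarith) (by linarith)
    _ = _ := Real.mul_rpow (by norm_num) (by linarith)

lemma exists_sum_rpow_critical_le (d : ℕ) :
    ∃ A : ℝ, 0 < A ∧ ∀ M : ℕ, 1 ≤ M → ∀ S : Finset (Fin d → ℤ),
      (∀ n ∈ S, zNorm n ≤ M) →
        ∑ n ∈ S, latticeWeight n ^ (-(d : ℝ)) ≤ A * Real.log ((M : ℝ) + 1) := by
  have hl2 : 0 < Real.log 2 := Real.log_pos (by norm_num)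
  refine ⟨6 ^ d * (2 / Real.log 2), by positivity, fun M hM S hS => ?_⟩
  have hM' : (1 : ℝ) ≤ M := by exact_mod_cast hM
  set J := Nat.log 2 ⌊(M : ℝ) + 1⌋₊ with hJ
  have h := sum_rpow_le_sum_geometric (Nat.cast_nonneg d) 0 (J + 1) S fun n hn =>
    ⟨Nat.zero_le _, Nat.lt_succ_of_le (dyadicScale_le (by
      rw [latticeWeight]; linarith [hS n hn]))⟩
  refine h.trans ?_
  rw [mul_assoc]
  gcongr
  have h2 : (2 : ℝ) ^ J ≤ (M : ℝ) + 1 := two_pow_log_floor_le (by linarith)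
  have h3 : J * Real.log 2 ≤ Real.log ((M : ℝ) + 1) := by
    rw [← Real.log_pow]
    exact Real.log_le_log (by positivity) h2
  have h4 : Real.log 2 ≤ Real.log ((M : ℝ) + 1) :=
    Real.log_le_log (by norm_num) (by linarith)
  simp only [sub_self, Real.rpow_zero, one_pow, Finset.sum_const, Nat.card_Ico, nsmul_eq_mul,
    mul_one, tsub_zero]
  rw [div_mul_eq_mul_div, le_div_iff₀ hl2]
  push_cast
  linarith

/-! ### Trigonometric sums on the unit cube -/

/-- Lebesgue measure on the unit cube `[0,1]^d`. -/
noncomputable abbrev cubeMeasure (d : ℕ) : Measure (Fin d → ℝ) :=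
  volume.restrict (Set.univ.pi fun _ : Fin d => Set.Icc (0 : ℝ) 1)

/-- The character `x ↦ e^{2πi⟨x,n⟩}`. -/
noncomputable def latticeChar {d : ℕ} (n : Fin d → ℤ) (x : Fin d → ℝ) : ℂ :=
  Complex.exp (2 * (π : ℂ) * Complex.I * (∑ i, (x i : ℂ) * (n i : ℂ)))

/-- The trigonometric sum with coefficients `c` and frequencies in `S`. -/
noncomputable def trigSum {d : ℕ} (S : Finset (Fin d → ℤ)) (c : (Fin d → ℤ) → ℝ)
    (x : Fin d → ℝ) : ℂ :=
  ∑ n ∈ S, (c n : ℂ) * latticeChar n x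

instance isProbabilityMeasure_cubeMeasure (d : ℕ) : IsProbabilityMeasure (cubeMeasure d) := by
  constructor
  rw [Measure.restrict_apply_univ, volume_pi_pi]
  simp

lemma latticeChar_eq_exp_ofReal {d : ℕ} (n : Fin d → ℤ) (x : Fin d → ℝ) :
    latticeChar n x = Complex.exp ((2 * π * ∑ i, x i * n i : ℝ) * Complex.I) := by
  unfold latticeChar
  push_cast
  ring_nf

lemma norm_latticeChar {d : ℕ} (n : Fin d → ℤ) (x : Fin d → ℝ) : ‖latticeChar n x‖ = 1 := by
  rw [latticeChar_eq_exp_ofReal, Complex.norm_exp_ofReal_mul_I]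

lemma re_latticeChar {d : ℕ} (n : Fin d → ℤ) (x : Fin d → ℝ) :
    (latticeChar n x).re = Real.cos (2 * π * ∑ i, x i * n i) := by
  rw [latticeChar_eq_exp_ofReal, Complex.exp_ofReal_mul_I_re]

lemma continuous_latticeChar {d : ℕ} (n : Fin d → ℤ) : Continuous (latticeChar n) := by
  unfold latticeChar
  fun_prop

lemma continuous_trigSum {d : ℕ} (S : Finset (Fin d → ℤ)) (c : (Fin d → ℤ) → ℝ) :
    Continuous (trigSum S c) :=
  continuous_finsetSum _ fun n _ => continuous_const.mul (continuous_latticeChar n)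

lemma norm_trigSum_le {d : ℕ} (S : Finset (Fin d → ℤ)) (c : (Fin d → ℤ) → ℝ)
    (x : Fin d → ℝ) : ‖trigSum S c x‖ ≤ ∑ n ∈ S, |c n| := by
  refine (norm_sum_le _ _).trans (Finset.sum_le_sum fun n _ => ?_)
  rw [norm_mul, norm_latticeChar, mul_one, Complex.norm_real, Real.norm_eq_abs]

lemma integrable_cubeMeasure {d : ℕ} {E : Type*} [NormedAddCommGroup E] {f : (Fin d → ℝ) → E}
    (hf : Continuous f) : Integrable f (cubeMeasure d) :=
  hf.continuousOn.integrableOn_compact (isCompact_univ_pi fun _ => isCompact_Icc)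

lemma latticeChar_mul_conj {d : ℕ} (n m : Fin d → ℤ) (x : Fin d → ℝ) :
    latticeChar n x * (starRingEnd ℂ) (latticeChar m x) = latticeChar (n - m) x := by
  rw [latticeChar_eq_exp_ofReal, latticeChar_eq_exp_ofReal, latticeChar_eq_exp_ofReal,
    ← Complex.exp_conj, ← Complex.exp_add]
  congr 1
  rw [map_mul, Complex.conj_I, Complex.conj_ofReal, mul_neg, ← sub_eq_add_neg, ← sub_mul,
    ← Complex.ofReal_sub, ← mul_sub, ← Finset.sum_sub_distrib]
  simp [mul_sub]

lemma integral_exp_two_pi_int {k : ℤ} (hk : k ≠ 0) :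
    ∫ t in Set.Icc (0 : ℝ) 1, Complex.exp (2 * (π : ℂ) * Complex.I * ((t : ℂ) * (k : ℂ))) = 0 := by
  rw [integral_Icc_eq_integral_Ioc, ← intervalIntegral.integral_of_le zero_le_one]
  have hc : (k : ℂ) * (2 * (π : ℂ) * Complex.I) ≠ 0 :=
    mul_ne_zero (Int.cast_ne_zero.2 hk) Complex.two_pi_I_ne_zero
  have h : ∀ t : ℝ, Complex.exp (2 * (π : ℂ) * Complex.I * ((t : ℂ) * (k : ℂ))) =
      Complex.exp ((k : ℂ) * (2 * (π : ℂ) * Complex.I) * t) := fun t => by ring_nf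
  simp_rw [h]
  rw [integral_exp_mul_complex hc]
  simp [Complex.exp_int_mul_two_pi_mul_I]

lemma integral_latticeChar_of_ne {d : ℕ} {n : Fin d → ℤ} (hn : n ≠ 0) :
    ∫ x, latticeChar n x ∂(cubeMeasure d) = 0 := by
  obtain ⟨i, hi⟩ := Function.ne_iff.1 hn
  have hprod : ∀ x : Fin d → ℝ, latticeChar n x =
      ∏ i, Complex.exp (2 * (π : ℂ) * Complex.I * ((x i : ℂ) * (n i : ℂ))) := fun x => by
    rw [latticeChar, Finset.mul_sum, Complex.exp_sum]
  simp_rw [hprod]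
  rw [cubeMeasure, volume_pi, Measure.restrict_pi_pi, integral_fintype_prod_eq_prod
    (f := fun i (t : ℝ) => Complex.exp (2 * (π : ℂ) * Complex.I * ((t : ℂ) * (n i : ℂ))))]
  exact Finset.prod_eq_zero (Finset.mem_univ i) (integral_exp_two_pi_int hi)

lemma integral_norm_trigSum_sq {d : ℕ} (S : Finset (Fin d → ℤ)) (c : (Fin d → ℤ) → ℝ) :
    ∫ x, ‖trigSum S c x‖ ^ 2 ∂(cubeMeasure d) = ∑ n ∈ S, c n ^ 2 := by
  have hexp : ∀ x, ((‖trigSum S c x‖ ^ 2 : ℝ) : ℂ) =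
      ∑ n ∈ S, ∑ m ∈ S, (c n * c m : ℂ) * latticeChar (n - m) x := fun x => by
    rw [Complex.sq_norm, ← Complex.mul_conj, trigSum, map_sum, Finset.sum_mul_sum]
    refine Finset.sum_congr rfl fun n _ => Finset.sum_congr rfl fun m _ => ?_
    rw [← latticeChar_mul_conj, map_mul, Complex.conj_ofReal]
    ring
  have hint : ∀ n m, Integrable (fun x => (c n * c m : ℂ) * latticeChar (n - m) x)
      (cubeMeasure d) := fun n m =>
    integrable_cubeMeasure (continuous_const.mul (continuous_latticeChar _))
  apply Complex.ofReal_injective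
  rw [← integral_complex_ofReal]
  simp_rw [hexp]
  rw [integral_finsetSum _ fun n _ => integrable_finsetSum _ fun m _ => hint n m]
  push_cast
  refine Finset.sum_congr rfl fun n hn => ?_
  rw [integral_finsetSum _ fun m _ => hint n m, Finset.sum_eq_single_of_mem n hn]
  · rw [integral_const_mul, sub_self]
    simp [latticeChar, sq]
  · intro m _ hmn
    rw [integral_const_mul, integral_latticeChar_of_ne (sub_ne_zero.2 hmn.symm), mul_zero]

lemma lintegral_norm_trigSum_sq {d : ℕ} (S : Finset (Fin d → ℤ)) (c : (Fin d → ℤ) → ℝ) :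
    ∫⁻ x, ENNReal.ofReal (‖trigSum S c x‖ ^ 2) ∂(cubeMeasure d) =
      ENNReal.ofReal (∑ n ∈ S, c n ^ 2) := by
  rw [← integral_norm_trigSum_sq, ofReal_integral_eq_lintegral_ofReal]
  · exact integrable_cubeMeasure ((continuous_trigSum S c).norm.pow 2)
  · exact Filter.Eventually.of_forall fun x => by positivity

lemma measure_lt_norm_trigSum_le {d : ℕ} (S : Finset (Fin d → ℤ)) (c : (Fin d → ℤ) → ℝ)
    {t : ℝ} (ht : 0 < t) :
    cubeMeasure d {x | t < ‖trigSum S c x‖} ≤ ENNReal.ofReal ((∑ n ∈ S, c n ^ 2) / t ^ 2) := by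
  have h := mul_meas_ge_le_lintegral₀ (μ := cubeMeasure d)
    (f := fun x => ENNReal.ofReal (‖trigSum S c x‖ ^ 2))
    (by have := continuous_trigSum S c
        exact (by fun_prop : Measurable _).aemeasurable) (ENNReal.ofReal (t ^ 2))
  rw [lintegral_norm_trigSum_sq] at h
  rw [ENNReal.ofReal_div_of_pos (by positivity), ENNReal.le_div_iff_mul_le
    (Or.inl (by simpa using ht.ne')) (Or.inl ENNReal.ofReal_ne_top), mul_comm]
  refine le_trans ?_ h
  gcongr
  intro hx
  gcongr

/-- Splitting the frequencies at height `t` according to the size of `τ` bounds the distribution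
function of a trigonometric sum by `ℓ²` masses. -/
lemma measure_lt_norm_trigSum_le_of_split {d : ℕ} (S : Finset (Fin d → ℤ))
    (c τ : (Fin d → ℤ) → ℝ) {K : ℝ} (hK : 0 < K)
    (hτ : ∀ t : ℝ, 0 < t → ∑ n ∈ S with τ n ≤ t, |c n| ≤ K * t) {t : ℝ} (ht : 0 < t) :
    cubeMeasure d {x | t < ‖trigSum S c x‖} ≤
      ENNReal.ofReal (4 * (∑ n ∈ S with t < 2 * K * τ n, c n ^ 2) / t ^ 2) := by
  have hfilter : ∀ n, (¬ τ n ≤ t / (2 * K)) ↔ t < 2 * K * τ n := fun n => by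
    rw [not_le, div_lt_iff₀ (by positivity), mul_comm (τ n)]
  have hsplit : ∀ x, trigSum S c x = trigSum {n ∈ S | τ n ≤ t / (2 * K)} c x +
      trigSum {n ∈ S | t < 2 * K * τ n} c x := fun x => by
    simp_rw [← hfilter]
    exact (Finset.sum_filter_add_sum_filter_not S _ _).symm
  have hlow : ∀ x, ‖trigSum {n ∈ S | τ n ≤ t / (2 * K)} c x‖ ≤ t / 2 := fun x => by
    refine ((norm_trigSum_le _ _ _).trans (hτ _ (by positivity))).trans_eq ?_
    field_simp
  have hsub : {x | t < ‖trigSum S c x‖} ⊆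
      {x | t / 2 < ‖trigSum {n ∈ S | t < 2 * K * τ n} c x‖} := by
    intro x hx
    simp only [Set.mem_ofPred_eq, hsplit x] at hx ⊢
    linarith [norm_add_le (trigSum {n ∈ S | τ n ≤ t / (2 * K)} c x)
      (trigSum {n ∈ S | t < 2 * K * τ n} c x), hlow x]
  refine (measure_mono hsub).trans ((measure_lt_norm_trigSum_le _ c (half_pos ht)).trans_eq ?_)
  congr 1
  field_simp
  ring

lemma lintegral_Ioi_ite_rpow {a r : ℝ} (ha : 0 ≤ a) (hr : 0 < r) :
    ∫⁻ t in Set.Ioi (0 : ℝ), ENNReal.ofReal (if t < a then t ^ (r - 1) else 0) =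
      ENNReal.ofReal (a ^ r / r) := by
  have hind : ∀ t ∈ Set.Ioi (0 : ℝ), ENNReal.ofReal (if t < a then t ^ (r - 1) else 0) =
      (Set.Ioo 0 a).indicator (fun t => ENNReal.ofReal (t ^ (r - 1))) t := by
    intro t ht
    by_cases h : t < a
    · rw [if_pos h, Set.indicator_of_mem (show t ∈ Set.Ioo 0 a from ⟨ht, h⟩)]
    · rw [if_neg h, Set.indicator_of_notMem (fun h' => h h'.2), ENNReal.ofReal_zero]
  rw [setLIntegral_congr_fun measurableSet_Ioi hind, lintegral_indicator measurableSet_Ioo,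
    Measure.restrict_restrict measurableSet_Ioo,
    Set.inter_eq_left.2 (Set.Ioo_subset_Ioi_self : Set.Ioo 0 a ⊆ Set.Ioi 0),
    restrict_Ioo_eq_restrict_Ioc, ← ofReal_integral_eq_lintegral_ofReal]
  · rw [← intervalIntegral.integral_of_le ha, integral_rpow (Or.inl (by linarith)),
      sub_add_cancel, Real.zero_rpow hr.ne', sub_zero]
  · rw [← IntegrableOn, ← intervalIntegrable_iff_integrableOn_Ioc_of_le ha]
    exact intervalIntegral.intervalIntegrable_rpow' (by linarith)
  · refine (ae_restrict_iff' measurableSet_Ioc).2 (Filter.Eventually.of_forall fun t ht => ?_)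
    exact Real.rpow_nonneg ht.1.le _

lemma lintegral_norm_trigSum_rpow_le {d : ℕ} {q : ℝ} (hq : 2 < q) (S : Finset (Fin d → ℤ))
    (c τ : (Fin d → ℤ) → ℝ) {K : ℝ} (hK : 0 < K) (hτ0 : ∀ n ∈ S, 0 ≤ τ n)
    (hτ : ∀ t : ℝ, 0 < t → ∑ n ∈ S with τ n ≤ t, |c n| ≤ K * t) :
    ∫⁻ x, ENNReal.ofReal (‖trigSum S c x‖ ^ q) ∂(cubeMeasure d) ≤
      ENNReal.ofReal (q * (4 * (2 * K) ^ (q - 2) / (q - 2)) *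
        ∑ n ∈ S, c n ^ 2 * τ n ^ (q - 2)) := by
  rw [lintegral_rpow_eq_lintegral_meas_lt_mul _
    (Filter.Eventually.of_forall fun x => norm_nonneg _)
    (continuous_trigSum S c).norm.measurable.aemeasurable (by linarith), mul_assoc,
    ENNReal.ofReal_mul (by linarith)]
  gcongr
  have hbound : ∀ t ∈ Set.Ioi (0 : ℝ),
      cubeMeasure d {x | t < ‖trigSum S c x‖} * ENNReal.ofReal (t ^ (q - 1)) ≤
        ∑ n ∈ S, ENNReal.ofReal (4 * c n ^ 2) *
          ENNReal.ofReal (if t < 2 * K * τ n then t ^ (q - 2 - 1) else 0) := by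
    intro t ht
    rw [Set.mem_Ioi] at ht
    refine (mul_le_mul_left (measure_lt_norm_trigSum_le_of_split S c τ hK hτ ht) _).trans_eq ?_
    have hsum : ∑ n ∈ S, ENNReal.ofReal (4 * c n ^ 2) *
        ENNReal.ofReal (if t < 2 * K * τ n then t ^ (q - 2 - 1) else 0) =
        ∑ n ∈ S, ENNReal.ofReal
          (4 * c n ^ 2 * if t < 2 * K * τ n then t ^ (q - 2 - 1) else 0) :=
      Finset.sum_congr rfl fun n _ => (ENNReal.ofReal_mul (by positivity)).symm
    rw [hsum, ← ENNReal.ofReal_mul (by positivity), ← ENNReal.ofReal_sum_of_nonneg]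
    · congr 1
      have hpow : t ^ (q - 1) = t ^ (q - 2 - 1) * t ^ 2 := by
        rw [← Real.rpow_natCast, ← Real.rpow_add ht]
        congr 1
        push_cast
        ring
      rw [hpow, Finset.sum_filter]
      field_simp
      rw [Finset.mul_sum, Finset.sum_mul]
      refine Finset.sum_congr rfl fun n _ => ?_
      split_ifs <;> ring
    · intro n _
      positivity
  refine (setLIntegral_mono' measurableSet_Ioi hbound).trans_eq ?_
  rw [lintegral_finsetSum _ fun n _ => by
    refine (Measurable.ennreal_ofReal ?_).const_mul _
    exact Measurable.ite (measurableSet_lt measurable_id measurable_const)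
      (measurable_id.pow_const _) measurable_const]
  have hterm : ∀ n ∈ S, ∫⁻ t in Set.Ioi (0 : ℝ), ENNReal.ofReal (4 * c n ^ 2) *
      ENNReal.ofReal (if t < 2 * K * τ n then t ^ (q - 2 - 1) else 0) =
      ENNReal.ofReal (4 * (2 * K) ^ (q - 2) / (q - 2) * (c n ^ 2 * τ n ^ (q - 2))) := by
    intro n hn
    have hτn := hτ0 n hn
    rw [lintegral_const_mul' _ _ ENNReal.ofReal_ne_top,
      lintegral_Ioi_ite_rpow (by positivity) (by linarith),
      ← ENNReal.ofReal_mul (by positivity), Real.mul_rpow (by positivity) hτn]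
    congr 1
    ring
  have hq' : 0 < q - 2 := by linarith
  rw [Finset.sum_congr rfl hterm, ← ENNReal.ofReal_sum_of_nonneg, Finset.mul_sum]
  intro n hn
  have := hτ0 n hn
  positivity

/-! ### Weighted `ℓ^p → L^q` bounds at the critical exponent -/

lemma exists_sum_mul_rpow_low_le {d : ℕ} {p s : ℝ} (hp : 1 < p) (hs : 0 ≤ s)
    (hsd : s < d * (1 - 1 / p)) :
    ∃ A : ℝ, 0 < A ∧ ∀ R : ℝ, 0 < R → ∀ S : Finset (Fin d → ℤ),
      (∀ n ∈ S, latticeWeight n ≤ R) → ∀ a : (Fin d → ℤ) → ℝ, (∀ n, 0 ≤ a n) →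
        (∑ n ∈ S, a n * latticeWeight n ^ (-s)) ^ p ≤
          A * R ^ (p * (d * (1 - 1 / p) - s)) * ∑ n ∈ S, a n ^ p := by
  have hp0 : 0 < p := by linarith
  have hp1 : 0 < p - 1 := by linarith
  have hconj := Real.HolderConjugate.conjExponent hp
  have hp' : 0 < p.conjExponent := hconj.symm.pos
  have hlt : s * p.conjExponent < d := by
    rw [Real.conjExponent, mul_div_assoc', div_lt_iff₀ hp1]
    calc s * p < d * (1 - 1 / p) * p := by gcongr
      _ = d * (p - 1) := by field_simp
  obtain ⟨A, hA, h⟩ := exists_sum_rpow_low_le (mul_nonneg hs hp'.le) hlt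
  refine ⟨A ^ (p - 1), by positivity, fun R hR S hS a ha => ?_⟩
  have hw : ∀ n ∈ S, |latticeWeight n ^ (-s)| ^ p.conjExponent =
      latticeWeight n ^ (-(s * p.conjExponent)) := fun n _ => by
    rw [abs_of_pos (latticeWeight_rpow_pos n _), ← Real.rpow_mul (latticeWeight_pos n).le,
      neg_mul]
  have ha' : ∀ n ∈ S, |a n| ^ p = a n ^ p := fun n _ => by rw [abs_of_nonneg (ha n)]
  have hH := Real.inner_le_Lp_mul_Lq S a (fun n => latticeWeight n ^ (-s)) hconj
  rw [Finset.sum_congr rfl hw, Finset.sum_congr rfl ha'] at hH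
  have hsum0 : 0 ≤ ∑ n ∈ S, a n ^ p := Finset.sum_nonneg fun n _ => Real.rpow_nonneg (ha n) _
  have hsumw : 0 ≤ ∑ n ∈ S, latticeWeight n ^ (-(s * p.conjExponent)) :=
    Finset.sum_nonneg fun n _ => (latticeWeight_rpow_pos n _).le
  have hexp : 1 / p.conjExponent * p = p - 1 := by
    rw [Real.conjExponent]
    field_simp
  calc (∑ n ∈ S, a n * latticeWeight n ^ (-s)) ^ p
      ≤ ((∑ n ∈ S, a n ^ p) ^ (1 / p) *
          (∑ n ∈ S, latticeWeight n ^ (-(s * p.conjExponent))) ^ (1 / p.conjExponent)) ^ p := by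
        apply Real.rpow_le_rpow _ hH hp0.le
        exact Finset.sum_nonneg fun n _ => mul_nonneg (ha n) (latticeWeight_rpow_pos n _).le
    _ = (∑ n ∈ S, latticeWeight n ^ (-(s * p.conjExponent))) ^ (p - 1) * ∑ n ∈ S, a n ^ p := by
        rw [Real.mul_rpow (by positivity) (by positivity), ← Real.rpow_mul hsum0,
          ← Real.rpow_mul hsumw, one_div_mul_cancel hp0.ne', Real.rpow_one, hexp, mul_comm]
    _ ≤ (A * R ^ ((d : ℝ) - s * p.conjExponent)) ^ (p - 1) * ∑ n ∈ S, a n ^ p := by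
        gcongr
        exact h R hR S hS
    _ = A ^ (p - 1) * R ^ (p * (d * (1 - 1 / p) - s)) * ∑ n ∈ S, a n ^ p := by
        rw [Real.mul_rpow hA.le (by positivity), ← Real.rpow_mul hR.le]
        congr 3
        rw [Real.conjExponent]
        field_simp

lemma sq_mul_rpow_sub_two_le {b u p : ℝ} (hb : 0 ≤ b) (hu : 0 ≤ u) (hp : 2 ≤ p) :
    b ^ 2 * u ^ (p - 2) ≤ b ^ p + u ^ p := by
  have hsplit : ∀ x : ℝ, 0 ≤ x → x ^ p = x ^ 2 * x ^ (p - 2) := fun x hx => by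
    rw [← Real.rpow_natCast, ← Real.rpow_add_of_nonneg hx (by norm_num) (by linarith)]
    congr 1
    push_cast
    ring
  rcases le_total b u with h | h
  · calc b ^ 2 * u ^ (p - 2) ≤ u ^ 2 * u ^ (p - 2) := by gcongr
      _ = u ^ p := (hsplit u hu).symm
      _ ≤ _ := by linarith [Real.rpow_nonneg hb p]
  · calc b ^ 2 * u ^ (p - 2) ≤ b ^ 2 * b ^ (p - 2) := by
          gcongr
      _ = b ^ p := (hsplit b hb).symm
      _ ≤ _ := by linarith [Real.rpow_nonneg hu p]

/-- A Hardy inequality for partial sums ordered by the size of the frequency. -/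
lemma exists_sum_hardy_le {d : ℕ} {p s δ : ℝ} (hp : 1 < p) (hs : 0 ≤ s) (hδ : 0 < δ)
    (hsum : s + δ = d * (1 - 1 / p)) :
    ∃ A : ℝ, 0 < A ∧ ∀ S : Finset (Fin d → ℤ), ∀ b : (Fin d → ℤ) → ℝ, (∀ n, 0 ≤ b n) →
      ∑ n ∈ S, ((∑ m ∈ S with latticeWeight m ≤ latticeWeight n, b m * latticeWeight m ^ (-s)) *
        latticeWeight n ^ (-(δ + d / p))) ^ p ≤ A * ∑ n ∈ S, b n ^ p := by
  have hp0 : 0 < p := by linarith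
  set ε := δ / 2 with hε
  have hε0 : 0 < ε := half_pos hδ
  obtain ⟨A, hA, hlow⟩ := exists_sum_mul_rpow_low_le (d := d) (s := s + ε) hp (by linarith)
    (by linarith)
  obtain ⟨B, hB, htail⟩ := exists_sum_rpow_tail_le (d := d) (s := d + p * ε)
    (by linarith [mul_pos hp0 hε0])
  refine ⟨A * B, by positivity, fun S b hb => ?_⟩
  have hterm : ∀ n ∈ S, ((∑ m ∈ S with latticeWeight m ≤ latticeWeight n,
      b m * latticeWeight m ^ (-s)) * latticeWeight n ^ (-(δ + d / p))) ^ p ≤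
      ∑ m ∈ S, if latticeWeight m ≤ latticeWeight n then
        A * (b m ^ p * latticeWeight m ^ (p * ε)) * latticeWeight n ^ (-(d + p * ε)) else 0 := by
    intro n _
    have hwn := latticeWeight_pos n
    have h := hlow (latticeWeight n) hwn {m ∈ S | latticeWeight m ≤ latticeWeight n}
      (fun m hm => (Finset.mem_filter.1 hm).2) (fun m => b m * latticeWeight m ^ ε)
      (fun m => mul_nonneg (hb m) (latticeWeight_rpow_pos m _).le)
    have hcongr : ∀ m, b m * latticeWeight m ^ ε * latticeWeight m ^ (-(s + ε)) =
        b m * latticeWeight m ^ (-s) := fun m => by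
      rw [mul_assoc, ← Real.rpow_add (latticeWeight_pos m)]
      ring_nf
    have hcongr' : ∀ m, (b m * latticeWeight m ^ ε) ^ p =
        b m ^ p * latticeWeight m ^ (p * ε) := fun m => by
      rw [Real.mul_rpow (hb m) (latticeWeight_rpow_pos m _).le,
        ← Real.rpow_mul (latticeWeight_pos m).le, mul_comm ε]
    simp_rw [hcongr, hcongr'] at h
    rw [Real.mul_rpow (Finset.sum_nonneg fun m _ =>
      mul_nonneg (hb m) (latticeWeight_rpow_pos m _).le) (latticeWeight_rpow_pos n _).le]
    refine (mul_le_mul_of_nonneg_right h (by positivity)).trans_eq ?_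
    rw [← Finset.sum_filter, ← Finset.sum_mul, ← Finset.mul_sum, ← Real.rpow_mul hwn.le,
      mul_right_comm, mul_assoc A, ← Real.rpow_add hwn, mul_right_comm]
    congr 3
    rw [← hsum, hε]
    field_simp
    ring
  refine (Finset.sum_le_sum hterm).trans ?_
  rw [Finset.sum_comm, Finset.mul_sum]
  refine Finset.sum_le_sum fun m _ => ?_
  have hwm := latticeWeight_pos m
  rw [← Finset.sum_filter, ← Finset.mul_sum]
  have h := htail (latticeWeight m) (one_le_latticeWeight m)
    {n ∈ S | latticeWeight m ≤ latticeWeight n} (fun n hn => (Finset.mem_filter.1 hn).2)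
  have hbm := hb m
  calc _ ≤ A * (b m ^ p * latticeWeight m ^ (p * ε)) *
        (B * latticeWeight m ^ ((d : ℝ) - (d + p * ε))) := by gcongr
    _ = A * B * b m ^ p * (latticeWeight m ^ (p * ε) *
        latticeWeight m ^ ((d : ℝ) - (d + p * ε))) := by ring
    _ = A * B * b m ^ p := by
        rw [← Real.rpow_add hwm]
        ring_nf
        simp

lemma exists_lintegral_le_of_two_le {d : ℕ} (hd : 1 ≤ d) {p q γ : ℝ} (hp : 2 ≤ p) (hpq : p ≤ q)
    (hq : 2 < q) (hγ : γ = d * (1 - 1 / p - 1 / q)) :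
    ∃ C : ℝ, 0 < C ∧ ∀ S : Finset (Fin d → ℤ), ∀ c : (Fin d → ℤ) → ℝ,
      ∑ n ∈ S, (|c n| * latticeWeight n ^ γ) ^ p ≤ 1 →
        ∫⁻ x, ENNReal.ofReal (‖trigSum S c x‖ ^ q) ∂(cubeMeasure d) ≤ ENNReal.ofReal C := by
  have hd0 : (0 : ℝ) < d := by exact_mod_cast hd
  have hp0 : 0 < p := by linarith
  have hq0 : 0 < q := by linarith
  have hγ0 : 0 ≤ γ := by
    have h1 : 1 / p ≤ 1 / 2 := one_div_le_one_div_of_le (by norm_num) hp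
    have h2 : 1 / q ≤ 1 / 2 := one_div_le_one_div_of_le (by norm_num) hq.le
    rw [hγ]
    exact mul_nonneg hd0.le (by linarith)
  have hδ : 0 < (d : ℝ) / q := by positivity
  have hsum : γ + d / q = d * (1 - 1 / p) := by rw [hγ]; ring
  obtain ⟨A, hA, hlow⟩ := exists_sum_mul_rpow_low_le (d := d) (s := γ) (p := p) (by linarith) hγ0
    (by linarith)
  obtain ⟨B, hB, hhardy⟩ := exists_sum_hardy_le (p := p) (by linarith) hγ0 hδ hsum
  set D : ℝ := (A ^ (1 / p)) ^ (q - p) with hD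
  have hD0 : 0 < D := by positivity
  have hq2 : 0 < q - 2 := by linarith
  refine ⟨q * (4 * (2 * 1) ^ (q - 2) / (q - 2)) * (D * (1 + B)), by positivity,
    fun S c hc => ?_⟩
  set b : (Fin d → ℤ) → ℝ := fun n => |c n| * latticeWeight n ^ γ with hb
  have hb0 : ∀ n, 0 ≤ b n := fun n => mul_nonneg (abs_nonneg _) (latticeWeight_rpow_pos n _).le
  have hcb : ∀ n, b n * latticeWeight n ^ (-γ) = |c n| := fun n => by
    rw [hb, mul_assoc, ← Real.rpow_add (latticeWeight_pos n), add_neg_cancel, Real.rpow_zero,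
      mul_one]
  set τ : (Fin d → ℤ) → ℝ := fun n => ∑ m ∈ S with latticeWeight m ≤ latticeWeight n, |c m|
    with hτ
  have hτ0 : ∀ n, 0 ≤ τ n := fun n => Finset.sum_nonneg fun m _ => abs_nonneg _
  have hτb : ∀ n, ∑ m ∈ S with latticeWeight m ≤ latticeWeight n,
      b m * latticeWeight m ^ (-γ) = τ n := fun n => Finset.sum_congr rfl fun m _ => hcb m
  have hsplit : ∀ t : ℝ, 0 < t → ∑ n ∈ S with τ n ≤ t, |c n| ≤ 1 * t := by
    intro t ht
    rw [one_mul]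
    rcases (S.filter fun n => τ n ≤ t).eq_empty_or_nonempty with h | h
    · rw [h, Finset.sum_empty]
      exact ht.le
    · obtain ⟨m, hm, hmax⟩ := Finset.exists_max_image _ latticeWeight h
      refine le_trans ?_ (Finset.mem_filter.1 hm).2
      refine Finset.sum_le_sum_of_subset_of_nonneg (fun n hn => ?_) fun _ _ _ => abs_nonneg _
      exact Finset.mem_filter.2 ⟨(Finset.mem_filter.1 hn).1, hmax n hn⟩
  have hτle : ∀ n, τ n ≤ A ^ (1 / p) * latticeWeight n ^ ((d : ℝ) / q) := by
    intro n
    have hwn := latticeWeight_pos n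
    have h := hlow (latticeWeight n) hwn {m ∈ S | latticeWeight m ≤ latticeWeight n}
      (fun m hm => (Finset.mem_filter.1 hm).2) b hb0
    rw [hτb, ← hsum, add_sub_cancel_left] at h
    have h1 : ∑ m ∈ S with latticeWeight m ≤ latticeWeight n, b m ^ p ≤ 1 :=
      (Finset.sum_le_sum_of_subset_of_nonneg (Finset.filter_subset _ _)
        fun m _ _ => Real.rpow_nonneg (hb0 m) _).trans hc
    rw [← Real.rpow_le_rpow_iff (hτ0 n) (by positivity) hp0,
      Real.mul_rpow (by positivity) (by positivity), ← Real.rpow_mul hA.le,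
      ← Real.rpow_mul hwn.le, one_div_mul_cancel hp0.ne', Real.rpow_one, mul_comm _ p]
    exact h.trans (mul_le_of_le_one_right (by positivity) h1)
  refine (lintegral_norm_trigSum_rpow_le hq S c τ one_pos (fun n _ => hτ0 n) hsplit).trans ?_
  gcongr
  have hterm : ∀ n ∈ S, c n ^ 2 * τ n ^ (q - 2) ≤
      D * (b n ^ p + (τ n * latticeWeight n ^ (-(d / q + d / p : ℝ))) ^ p) := by
    intro n _
    have hwn := latticeWeight_pos n
    have hτn := hτ0 n
    have hpow : τ n ^ (q - 2) = τ n ^ (p - 2) * τ n ^ (q - p) := by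
      rw [← Real.rpow_add_of_nonneg (hτ0 n) (by linarith) (by linarith)]
      ring_nf
    have hτq : τ n ^ (q - p) ≤ D * latticeWeight n ^ ((d : ℝ) / q * (q - p)) := by
      rw [hD, Real.rpow_mul hwn.le, ← Real.mul_rpow (by positivity) (by positivity)]
      exact Real.rpow_le_rpow (hτ0 n) (hτle n) (by linarith)
    calc c n ^ 2 * τ n ^ (q - 2) = c n ^ 2 * τ n ^ (p - 2) * τ n ^ (q - p) := by
          rw [hpow, mul_assoc]
      _ ≤ c n ^ 2 * τ n ^ (p - 2) * (D * latticeWeight n ^ ((d : ℝ) / q * (q - p))) := by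
          gcongr
      _ = D * (b n ^ 2 * (τ n * latticeWeight n ^ (-(d / q + d / p : ℝ))) ^ (p - 2)) := by
          rw [← sq_abs (c n), ← hcb n, mul_pow, Real.mul_rpow hτn (by positivity),
            ← Real.rpow_natCast (latticeWeight n ^ (-γ)), ← Real.rpow_mul hwn.le,
            ← Real.rpow_mul hwn.le]
          have hw : latticeWeight n ^ (-γ * (2 : ℕ)) * latticeWeight n ^ ((d : ℝ) / q * (q - p)) =
              latticeWeight n ^ (-(d / q + d / p : ℝ) * (p - 2)) := by
            rw [← Real.rpow_add hwn, hγ]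
            congr 1
            push_cast
            field_simp
            ring
          rw [← hw]
          ring
      _ ≤ _ := by
          gcongr
          exact sq_mul_rpow_sub_two_le (hb0 n) (by positivity) hp
  refine (Finset.sum_le_sum hterm).trans ?_
  rw [← Finset.mul_sum, Finset.sum_add_distrib]
  have h := hhardy S b hb0
  simp_rw [hτb] at h
  have h1 : B * ∑ n ∈ S, b n ^ p ≤ B * 1 := by gcongr
  gcongr
  linarith

lemma exists_lintegral_le_of_lt_two {d : ℕ} (hd : 1 ≤ d) {p q γ : ℝ} (hp : 1 < p) (hp2 : p < 2)
    (hq : 2 < q) (hγ : γ = d * (1 - 1 / p - 1 / q)) (hγ0 : 0 ≤ γ) :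
    ∃ C : ℝ, 0 < C ∧ ∀ S : Finset (Fin d → ℤ), ∀ c : (Fin d → ℤ) → ℝ,
      ∑ n ∈ S, (|c n| * latticeWeight n ^ γ) ^ p ≤ 1 →
        ∫⁻ x, ENNReal.ofReal (‖trigSum S c x‖ ^ q) ∂(cubeMeasure d) ≤ ENNReal.ofReal C := by
  have hd0 : (0 : ℝ) < d := by exact_mod_cast hd
  have hp0 : 0 < p := by linarith
  have hq0 : 0 < q := by linarith
  have hδ : 0 < (d : ℝ) / q := by positivity
  have hsum : γ + d / q = d * (1 - 1 / p) := by rw [hγ]; ring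
  obtain ⟨A, hA, hlow⟩ := exists_sum_mul_rpow_low_le (d := d) (s := γ) (p := p) hp hγ0
    (by linarith)
  have hq2 : 0 < q - 2 := by linarith
  have h2p : 0 < 2 - p := by linarith
  set K : ℝ := A ^ (1 / p) + 1 with hK
  have hK0 : 0 < K := by positivity
  refine ⟨q * (4 * (2 * K) ^ (q - 2) / (q - 2)) * 1, by positivity, fun S c hc => ?_⟩
  set b : (Fin d → ℤ) → ℝ := fun n => |c n| * latticeWeight n ^ γ with hb
  have hb0 : ∀ n, 0 ≤ b n := fun n => mul_nonneg (abs_nonneg _) (latticeWeight_rpow_pos n _).le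
  have hcb : ∀ n, b n * latticeWeight n ^ (-γ) = |c n| := fun n => by
    rw [hb, mul_assoc, ← Real.rpow_add (latticeWeight_pos n), add_neg_cancel, Real.rpow_zero,
      mul_one]
  set τ : (Fin d → ℤ) → ℝ := fun n =>
    b n ^ (-(2 - p) / (q - 2)) * latticeWeight n ^ (2 * γ / (q - 2)) with hτ
  have hτ0 : ∀ n, 0 ≤ τ n := fun n =>
    mul_nonneg (Real.rpow_nonneg (hb0 n) _) (latticeWeight_rpow_pos n _).le
  have hhigh : ∀ t : ℝ, 0 < t → ∀ n, τ n ≤ t → t ^ (q / d) < latticeWeight n →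
      |c n| ≤ t * b n ^ p := by
    intro t ht n hτn hn
    have hwn := latticeWeight_pos n
    rcases (hb0 n).eq_or_lt with h0 | hbn
    · rw [← hcb n, ← h0, zero_mul, Real.zero_rpow hp0.ne', mul_zero]
    rw [← hcb n, ← Real.log_le_log_iff (by positivity) (by positivity),
      Real.log_mul hbn.ne' (by positivity), Real.log_mul ht.ne' (by positivity),
      Real.log_rpow hwn, Real.log_rpow hbn]
    have h1 := Real.log_le_log (by positivity) hτn
    rw [hτ, Real.log_mul (by positivity) (by positivity), Real.log_rpow hwn,
      Real.log_rpow hbn] at h1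
    have h2 := Real.log_le_log (by positivity) hn.le
    rw [Real.log_rpow ht] at h2
    have h3 : -(2 - p) * Real.log (b n) + 2 * γ * Real.log (latticeWeight n) ≤
        (q - 2) * Real.log t := by
      have := mul_le_mul_of_nonneg_left h1 hq2.le
      field_simp at this
      linarith
    have h4 := mul_le_mul_of_nonneg_left h3 (by linarith : 0 ≤ p - 1)
    have h5 := mul_le_mul_of_nonneg_left h2 (mul_nonneg hp0.le hγ0)
    have h6 : p * γ * (q / d * Real.log t) = (p * q - p - q) * Real.log t := by
      rw [hγ]
      field_simp
      ring
    have h7 := le_of_mul_le_mul_left (a := 2 - p) (b := Real.log (b n) +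
      -γ * Real.log (latticeWeight n)) (c := Real.log t + p * Real.log (b n)) (by linarith) h2p
    linarith
  have hsplit : ∀ t : ℝ, 0 < t → ∑ n ∈ S with τ n ≤ t, |c n| ≤ K * t := by
    intro t ht
    set R : ℝ := t ^ (q / d) with hR
    have hR0 : 0 < R := by positivity
    rw [← Finset.sum_filter_add_sum_filter_not _ (fun n => latticeWeight n ≤ R), hK, add_mul]
    gcongr ?_ + ?_
    · have h := hlow R hR0 {n ∈ S | τ n ≤ t ∧ latticeWeight n ≤ R}
        (fun n hn => (Finset.mem_filter.1 hn).2.2) b hb0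
      have h1 : ∑ n ∈ S with τ n ≤ t ∧ latticeWeight n ≤ R, b n ^ p ≤ 1 :=
        (Finset.sum_le_sum_of_subset_of_nonneg (Finset.filter_subset _ _)
          fun m _ _ => Real.rpow_nonneg (hb0 m) _).trans hc
      simp_rw [hcb] at h
      rw [Finset.filter_filter, ← Real.rpow_le_rpow_iff
        (Finset.sum_nonneg fun _ _ => abs_nonneg _) (by positivity) hp0,
        Real.mul_rpow (by positivity) ht.le, ← Real.rpow_mul hA.le, one_div_mul_cancel hp0.ne',
        Real.rpow_one]
      refine (h.trans (mul_le_of_le_one_right (by positivity) h1)).trans_eq ?_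
      rw [hR, ← Real.rpow_mul ht.le, ← hsum, add_sub_cancel_left]
      congr 2
      field_simp
    · calc _ ≤ ∑ n ∈ S.filter (fun n => τ n ≤ t) with ¬ latticeWeight n ≤ R, t * b n ^ p := by
            refine Finset.sum_le_sum fun n hn => ?_
            rw [Finset.mem_filter, Finset.mem_filter, not_le] at hn
            exact hhigh t ht n hn.1.2 hn.2
        _ ≤ ∑ n ∈ S, t * b n ^ p := by
            refine Finset.sum_le_sum_of_subset_of_nonneg
              ((Finset.filter_subset _ _).trans (Finset.filter_subset _ _)) fun n _ _ => ?_
            exact mul_nonneg ht.le (Real.rpow_nonneg (hb0 n) _)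
        _ ≤ 1 * t := by
            rw [← Finset.mul_sum, mul_comm]
            gcongr
  refine (lintegral_norm_trigSum_rpow_le hq S c τ hK0 (fun n _ => hτ0 n) hsplit).trans ?_
  gcongr
  refine (Finset.sum_le_sum fun n _ => ?_).trans (hc : ∑ n ∈ S, b n ^ p ≤ 1)
  have hwn := latticeWeight_pos n
  rcases (hb0 n).eq_or_lt with h0 | hbn
  · have hc0 : c n = 0 := by rw [← abs_eq_zero, ← hcb n, ← h0, zero_mul]
    simp [hc0, hp0.ne']
  · change _ ≤ b n ^ p
    rw [← sq_abs, ← hcb n, hτ, Real.mul_rpow (by positivity) (by positivity),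
      ← Real.rpow_mul hbn.le, ← Real.rpow_mul hwn.le, div_mul_cancel₀ _ hq2.ne',
      div_mul_cancel₀ _ hq2.ne', mul_pow, ← Real.rpow_natCast, ← Real.rpow_natCast,
      ← Real.rpow_mul hwn.le, mul_mul_mul_comm, ← Real.rpow_add hbn, ← Real.rpow_add hwn]
    apply le_of_eq
    push_cast
    ring_nf
    simp

/-! ### Passage to `eLpNorm` -/

lemma eLpNorm_count_antitone {α E : Type*} [MeasurableSpace α] [MeasurableSingletonClass α]
    [NormedAddCommGroup E] (f : α → E) {p q : ℝ} (hp : 0 < p) (hpq : p ≤ q) :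
    eLpNorm f (ENNReal.ofReal q) Measure.count ≤ eLpNorm f (ENNReal.ofReal p) Measure.count := by
  have hq : 0 < q := hp.trans_le hpq
  set N := eLpNorm f (ENNReal.ofReal p) Measure.count with hN
  rcases eq_or_ne N ∞ with h | h
  · rw [h]
    exact le_top
  have hle : ∀ i, ‖f i‖ₑ ≤ N := fun i => enorm_le_eLpNorm_count f i (by simpa using hp)
  have hNp : ∫⁻ i, ‖f i‖ₑ ^ p ∂Measure.count = N ^ p := by
    rw [hN, eLpNorm_eq_lintegral_rpow_enorm_toReal (by simpa using hp) ENNReal.ofReal_ne_top,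
      ENNReal.toReal_ofReal hp.le, ← ENNReal.rpow_mul, one_div_mul_cancel hp.ne',
      ENNReal.rpow_one]
  rw [eLpNorm_eq_lintegral_rpow_enorm_toReal (by simpa using hq) ENNReal.ofReal_ne_top,
    ENNReal.toReal_ofReal hq.le, one_div, ENNReal.rpow_inv_le_iff hq]
  calc ∫⁻ i, ‖f i‖ₑ ^ q ∂Measure.count
      ≤ ∫⁻ i, N ^ (q - p) * ‖f i‖ₑ ^ p ∂Measure.count := by
        refine lintegral_mono fun i => ?_
        calc ‖f i‖ₑ ^ q = ‖f i‖ₑ ^ (q - p) * ‖f i‖ₑ ^ p := by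
              rw [← ENNReal.rpow_add_of_nonneg _ _ (by linarith) hp.le, sub_add_cancel]
          _ ≤ _ := by
              gcongr
              exact hle i
    _ = N ^ q := by
        rw [lintegral_const_mul' _ _ (ENNReal.rpow_ne_top_of_nonneg (by linarith) h), hNp,
          ← ENNReal.rpow_add_of_nonneg _ _ (by linarith) hp.le, sub_add_cancel]

lemma eLpNorm_count_eq_sum {α : Type*} [MeasurableSpace α] [MeasurableSingletonClass α]
    {S : Finset α} {f : α → ℝ} (hf : ∀ n ∉ S, f n = 0) {p : ℝ} (hp : 0 < p) :
    eLpNorm f (ENNReal.ofReal p) Measure.count =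
      ENNReal.ofReal ((∑ n ∈ S, |f n| ^ p) ^ (1 / p)) := by
  have hterm : ∀ n, ‖f n‖ₑ ^ p = ENNReal.ofReal (|f n| ^ p) := fun n => by
    rw [← ENNReal.ofReal_rpow_of_nonneg (abs_nonneg _) hp.le, Real.enorm_eq_ofReal_abs]
  rw [eLpNorm_eq_lintegral_rpow_enorm_toReal (by simpa using hp) ENNReal.ofReal_ne_top,
    ENNReal.toReal_ofReal hp.le, lintegral_count, tsum_eq_sum (s := S), Finset.sum_congr rfl
    fun n _ => hterm n, ← ENNReal.ofReal_sum_of_nonneg fun n _ => by positivity,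
    ENNReal.ofReal_rpow_of_nonneg (Finset.sum_nonneg fun n _ => by positivity) (by positivity)]
  intro n hn
  rw [hf n hn, enorm_zero, ENNReal.zero_rpow_of_pos hp]

lemma eLpNorm_trigSum_two {d : ℕ} {S : Finset (Fin d → ℤ)} {c : (Fin d → ℤ) → ℝ}
    (hc : ∀ n ∉ S, c n = 0) :
    eLpNorm (trigSum S c) (ENNReal.ofReal 2) (cubeMeasure d) =
      eLpNorm c (ENNReal.ofReal 2) Measure.count := by
  have hterm : ∀ x, ‖trigSum S c x‖ₑ ^ (2 : ℝ) = ENNReal.ofReal (‖trigSum S c x‖ ^ 2) := fun x => by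
    rw [← ofReal_norm, ENNReal.ofReal_rpow_of_nonneg (norm_nonneg _) (by norm_num),
      Real.rpow_two]
  rw [eLpNorm_count_eq_sum hc (by norm_num), eLpNorm_eq_lintegral_rpow_enorm_toReal (by simp)
    ENNReal.ofReal_ne_top, ENNReal.toReal_ofReal (by norm_num)]
  simp_rw [hterm]
  rw [lintegral_norm_trigSum_sq, ENNReal.ofReal_rpow_of_nonneg (Finset.sum_nonneg fun n _ =>
    sq_nonneg _) (by norm_num)]
  simp

lemma eLpNorm_mul_latticeWeight_mono {d : ℕ} (c : (Fin d → ℤ) → ℝ) {a b : ℝ} (hab : a ≤ b)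
    (p : ℝ≥0∞) :
    eLpNorm (fun n => c n * latticeWeight n ^ a) p Measure.count ≤
      eLpNorm (fun n => c n * latticeWeight n ^ b) p Measure.count := by
  refine eLpNorm_mono fun n => ?_
  rw [norm_mul, norm_mul, Real.norm_of_nonneg (latticeWeight_rpow_pos n a).le,
    Real.norm_of_nonneg (latticeWeight_rpow_pos n b).le]
  gcongr
  exact one_le_latticeWeight n

lemma exists_eLpNorm_trigSum_le_of_lintegral_le {d : ℕ} {p q γ : ℝ} (hp : 0 < p) (hq : 0 < q)
    (h : ∃ C : ℝ, 0 < C ∧ ∀ S : Finset (Fin d → ℤ), ∀ c : (Fin d → ℤ) → ℝ,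
      ∑ n ∈ S, (|c n| * latticeWeight n ^ γ) ^ p ≤ 1 →
        ∫⁻ x, ENNReal.ofReal (‖trigSum S c x‖ ^ q) ∂(cubeMeasure d) ≤ ENNReal.ofReal C) :
    ∃ C : ℝ, 0 < C ∧ ∀ S : Finset (Fin d → ℤ), ∀ c : (Fin d → ℤ) → ℝ, (∀ n ∉ S, c n = 0) →
      eLpNorm (trigSum S c) (ENNReal.ofReal q) (cubeMeasure d) ≤ ENNReal.ofReal C *
        eLpNorm (fun n => c n * latticeWeight n ^ γ) (ENNReal.ofReal p) Measure.count := by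
  obtain ⟨C, hC, h⟩ := h
  refine ⟨C ^ (1 / q), by positivity, fun S c hc => ?_⟩
  have habs : ∀ n, |c n * latticeWeight n ^ γ| = |c n| * latticeWeight n ^ γ := fun n => by
    rw [abs_mul, abs_of_pos (latticeWeight_rpow_pos n γ)]
  have hterm0 : ∀ n, 0 ≤ |c n| * latticeWeight n ^ γ := fun n =>
    mul_nonneg (abs_nonneg _) (latticeWeight_rpow_pos n γ).le
  rw [eLpNorm_count_eq_sum (S := S) (fun n hn => by rw [hc n hn, zero_mul]) hp]
  simp_rw [habs]
  set Q := ∑ n ∈ S, (|c n| * latticeWeight n ^ γ) ^ p with hQ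
  have hQ0 : 0 ≤ Q := Finset.sum_nonneg fun n _ => Real.rpow_nonneg (hterm0 n) _
  rcases hQ0.eq_or_lt with hQz | hQpos
  · have hcz : ∀ n ∈ S, c n = 0 := fun n hn => by
      have h1 := (Finset.sum_eq_zero_iff_of_nonneg
        fun n _ => Real.rpow_nonneg (hterm0 n) p).1 hQz.symm n hn
      rw [Real.rpow_eq_zero (hterm0 n) hp.ne'] at h1
      simpa [(latticeWeight_rpow_pos n γ).ne'] using h1
    have hT : trigSum S c = 0 := by
      funext x
      exact Finset.sum_eq_zero fun n hn => by rw [hcz n hn]; simp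
    rw [hT, eLpNorm_zero]
    exact zero_le
  set B := Q ^ (1 / p) with hB
  have hB0 : 0 < B := by positivity
  have hBp : B ^ p = Q := by
    rw [hB, ← Real.rpow_mul hQ0, one_div_mul_cancel hp.ne', Real.rpow_one]
  have hscale : trigSum S c = B • trigSum S (fun n => B⁻¹ * c n) := by
    funext x
    simp only [trigSum, Pi.smul_apply, Finset.smul_sum, Complex.real_smul]
    refine Finset.sum_congr rfl fun n _ => ?_
    push_cast
    have : (B : ℂ) ≠ 0 := by exact_mod_cast hB0.ne'
    field_simp
  have hnormalized := h S (fun n => B⁻¹ * c n) (by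
    have : ∀ n, (|B⁻¹ * c n| * latticeWeight n ^ γ) ^ p =
        Q⁻¹ * (|c n| * latticeWeight n ^ γ) ^ p := fun n => by
      rw [abs_mul, abs_of_pos (by positivity : 0 < B⁻¹), mul_assoc,
        Real.mul_rpow (by positivity) (hterm0 n), Real.inv_rpow hB0.le, hBp]
    simp_rw [this]
    rw [← Finset.mul_sum, ← hQ, inv_mul_cancel₀ hQpos.ne'])
  rw [hscale, eLpNorm_const_smul, mul_comm, Real.enorm_of_nonneg hB0.le]
  gcongr
  rw [eLpNorm_eq_lintegral_rpow_enorm_toReal (by simpa using hq) ENNReal.ofReal_ne_top,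
    ENNReal.toReal_ofReal hq.le, ← ENNReal.ofReal_rpow_of_nonneg hC.le (by positivity)]
  gcongr
  refine le_trans (le_of_eq ?_) hnormalized
  refine lintegral_congr fun x => ?_
  rw [← ofReal_norm, ENNReal.ofReal_rpow_of_nonneg (norm_nonneg _) hq.le]

/-- Hausdorff–Young and Pitt type inequality: the `L^q` norm of a trigonometric sum is controlled
by the `ℓ^p` norm of its coefficients with the critical power weight. -/
lemma exists_eLpNorm_trigSum_le {d : ℕ} (hd : 1 ≤ d) {p q : ℝ} (hp : 1 ≤ p) (hpq : p ≤ q) :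
    ∃ C : ℝ, 0 < C ∧ ∀ S : Finset (Fin d → ℤ), ∀ c : (Fin d → ℤ) → ℝ, (∀ n ∉ S, c n = 0) →
      eLpNorm (trigSum S c) (ENNReal.ofReal q) (cubeMeasure d) ≤ ENNReal.ofReal C *
        eLpNorm (fun n => c n * latticeWeight n ^ max (d * (1 - 1 / p - 1 / q)) 0)
          (ENNReal.ofReal p) Measure.count := by
  have hd0 : (0 : ℝ) < d := by exact_mod_cast hd
  have hp0 : 0 < p := by linarith
  have hq0 : 0 < q := by linarith
  set γ : ℝ := d * (1 - 1 / p - 1 / q) with hγ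
  rcases le_or_gt q 2 with hq | hq
  · refine ⟨1, one_pos, fun S c hc => ?_⟩
    rw [ENNReal.ofReal_one, one_mul]
    calc eLpNorm (trigSum S c) (ENNReal.ofReal q) (cubeMeasure d)
        ≤ eLpNorm (trigSum S c) (ENNReal.ofReal 2) (cubeMeasure d) :=
          eLpNorm_le_eLpNorm_of_exponent_le (ENNReal.ofReal_le_ofReal hq)
            (continuous_trigSum S c).aestronglyMeasurable
      _ = eLpNorm c (ENNReal.ofReal 2) Measure.count := eLpNorm_trigSum_two hc
      _ ≤ eLpNorm c (ENNReal.ofReal p) Measure.count :=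
          eLpNorm_count_antitone c hp0 (hpq.trans hq)
      _ = eLpNorm (fun n => c n * latticeWeight n ^ (0 : ℝ)) (ENNReal.ofReal p)
            Measure.count := by simp
      _ ≤ _ := eLpNorm_mul_latticeWeight_mono c (le_max_right _ _) _
  rcases le_or_gt 2 p with hp2 | hp2
  · obtain ⟨C, hC, h⟩ := exists_eLpNorm_trigSum_le_of_lintegral_le hp0 hq0
      (exists_lintegral_le_of_two_le hd hp2 hpq hq hγ)
    exact ⟨C, hC, fun S c hc => (h S c hc).trans (mul_le_mul_right
      (eLpNorm_mul_latticeWeight_mono c (le_max_left _ _) _) _)⟩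
  have hq1 : 1 / q < 1 / 2 := one_div_lt_one_div_of_lt (by norm_num) hq
  have hqpos : 0 < 1 / q := by positivity
  rcases le_or_gt 0 γ with hγ0 | hγ0
  · have hp1 : 1 < p := by
      refine hp.lt_of_ne fun h => ?_
      rw [hγ, ← h] at hγ0
      nlinarith
    obtain ⟨C, hC, h⟩ := exists_eLpNorm_trigSum_le_of_lintegral_le hp0 hq0
      (exists_lintegral_le_of_lt_two hd hp1 hp2 hq hγ hγ0)
    exact ⟨C, hC, fun S c hc => (h S c hc).trans (mul_le_mul_right
      (eLpNorm_mul_latticeWeight_mono c (le_max_left _ _) _) _)⟩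
  · have hγ' : 1 - 1 / p - 1 / q < 0 := by
      by_contra! hcon
      exact absurd (mul_nonneg hd0.le hcon) (not_le.2 hγ0)
    set r : ℝ := (1 - 1 / q)⁻¹ with hr
    have hr1 : 1 < r := (one_lt_inv₀ (by linarith)).2 (by linarith)
    have hr2 : r < 2 := by
      rw [hr, inv_lt_comm₀ (by linarith) (by norm_num)]
      linarith
    have hpr : p ≤ r := by
      rw [hr, le_inv_comm₀ hp0 (by linarith), ← one_div]
      linarith
    have hγr : (0 : ℝ) = d * (1 - 1 / r - 1 / q) := by
      rw [hr, one_div (1 - 1 / q)⁻¹, inv_inv]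
      ring
    obtain ⟨C, hC, h⟩ := exists_eLpNorm_trigSum_le_of_lintegral_le (by linarith) hq0
      (exists_lintegral_le_of_lt_two hd hr1 hr2 hq hγr le_rfl)
    refine ⟨C, hC, fun S c hc => (h S c hc).trans ?_⟩
    gcongr
    exact (eLpNorm_count_antitone _ hp0 hpr).trans
      (eLpNorm_mul_latticeWeight_mono c (le_max_right _ _) _)

/-! ### Reduction to finite sums -/

lemma trigPoly_eq_trigSum {d : ℕ} {S : Finset (Fin d → ℤ)} {c : (Fin d → ℤ) → ℝ}
    (hc : ∀ n ∉ S, c n = 0) : trigPoly c = trigSum S c := by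
  funext x
  refine finsum_eq_sum_of_support_subset _ fun n hn => ?_
  by_contra hnS
  exact hn (by simp [hc n hnS])

lemma trigConst_le {d : ℕ} {γ : ℝ} {q p : ℝ≥0∞} {M : ℕ} {X : ℝ≥0∞}
    (h : ∀ S : Finset (Fin d → ℤ), ∀ c : (Fin d → ℤ) → ℝ, (∀ n ∉ S, c n = 0) →
      (∀ n ∈ S, zNorm n ≤ M) → eLpNorm (trigSum S c) q (cubeMeasure d) ≤
        X * eLpNorm (fun n => c n * latticeWeight n ^ γ) p Measure.count) :
    trigConst d γ q p M ≤ X := by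
  refine iSup_le fun ⟨c, _, hfin, hM⟩ => ENNReal.div_le_of_le_mul ?_
  have hc : ∀ n ∉ hfin.toFinset, c n = 0 := fun n hn => by simpa using hn
  rw [trigPoly_eq_trigSum hc]
  refine h _ c hc fun n hn => ?_
  by_contra! hlt
  exact (hfin.mem_toFinset.1 hn) (hM n hlt)

lemma le_trigConst {d : ℕ} {γ : ℝ} {q p : ℝ≥0∞} {M : ℕ} {S : Finset (Fin d → ℤ)}
    {c : (Fin d → ℤ) → ℝ} (hc0 : c ≠ 0) (hc : ∀ n ∉ S, c n = 0) (hM : ∀ n ∈ S, zNorm n ≤ M)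
    {A B : ℝ} (hB : 0 < B)
    (hcB : eLpNorm (fun n => c n * latticeWeight n ^ γ) p Measure.count ≤ ENNReal.ofReal B)
    (hT : ENNReal.ofReal (A * B) ≤ eLpNorm (trigSum S c) q (cubeMeasure d)) :
    ENNReal.ofReal A ≤ trigConst d γ q p M := by
  have hsupp : Function.support c ⊆ S := fun n hn => by
    by_contra hnS
    exact hn (hc n hnS)
  refine le_trans ?_ (le_iSup _ ⟨c, hc0, S.finite_toSet.subset hsupp, fun n hn => hc n fun hnS =>
    absurd (hM n hnS) (not_le.2 hn)⟩)
  rw [trigPoly_eq_trigSum hc]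
  refine le_trans ?_ (ENNReal.div_le_div_left hcB _)
  rw [ENNReal.le_div_iff_mul_le (Or.inl (by simpa using hB)) (Or.inl ENNReal.ofReal_ne_top),
    ← ENNReal.ofReal_mul' hB.le]
  exact hT

/-! ### Upper bounds -/

lemma toReal_one_div_le_one {p : ℝ≥0∞} (hp : 1 ≤ p) : (1 / p).toReal ≤ 1 := by
  have : 1 / p ≤ 1 := by simpa using hp
  simpa using ENNReal.toReal_mono ENNReal.one_ne_top this

lemma toReal_one_div_lt_one {p : ℝ≥0∞} (hp : 1 < p) : (1 / p).toReal < 1 := by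
  have hpinv : p⁻¹ < 1 := ENNReal.inv_lt_one.2 hp
  rw [one_div]
  exact (ENNReal.toReal_lt_toReal hpinv.ne_top ENNReal.one_ne_top).2 hpinv

lemma trigConst_le_of_rpow {d : ℕ} {γ γ' C : ℝ} (hC : 0 < C) {q p : ℝ≥0∞} (hγ : γ ≤ γ')
    (h : ∀ S : Finset (Fin d → ℤ), ∀ c : (Fin d → ℤ) → ℝ, (∀ n ∉ S, c n = 0) →
      eLpNorm (trigSum S c) q (cubeMeasure d) ≤ ENNReal.ofReal C *
        eLpNorm (fun n => c n * latticeWeight n ^ γ') p Measure.count)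
    {M : ℕ} (hM : 1 ≤ M) :
    trigConst d γ q p M ≤ ENNReal.ofReal (C * 2 ^ (γ' - γ) * (M : ℝ) ^ (γ' - γ)) := by
  have hM1 : (1 : ℝ) ≤ M := by exact_mod_cast hM
  refine trigConst_le fun S c hc hS => (h S c hc).trans ?_
  rw [mul_assoc C, ENNReal.ofReal_mul hC.le, mul_assoc]
  gcongr
  rw [← Real.enorm_of_nonneg (by positivity : (0 : ℝ) ≤ 2 ^ (γ' - γ) * (M : ℝ) ^ (γ' - γ)),
    ← eLpNorm_const_smul]
  refine eLpNorm_mono fun n => ?_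
  by_cases hn : n ∈ S
  · have hw : latticeWeight n ≤ 2 * M := by
      have := hS n hn
      unfold latticeWeight
      linarith
    have hpow := Real.rpow_le_rpow (latticeWeight_pos n).le hw (sub_nonneg.2 hγ)
    have hsplit : latticeWeight n ^ γ' = latticeWeight n ^ (γ' - γ) * latticeWeight n ^ γ := by
      rw [← Real.rpow_add (latticeWeight_pos n), sub_add_cancel]
    have hw0 := latticeWeight_rpow_pos n γ
    rw [Real.mul_rpow (by norm_num) (by positivity)] at hpow
    simp only [Pi.smul_apply, smul_eq_mul, norm_mul]
    rw [hsplit, norm_mul, Real.norm_of_nonneg (latticeWeight_rpow_pos n _).le, ← norm_mul (2 ^ _),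
      Real.norm_of_nonneg (by positivity : (0 : ℝ) ≤ 2 ^ (γ' - γ) * (M : ℝ) ^ (γ' - γ)),
      mul_left_comm]
    gcongr
  · simp [hc n hn]

lemma eLpNorm_top_trigSum_le {d : ℕ} {S : Finset (Fin d → ℤ)} {c : (Fin d → ℤ) → ℝ}
    (hc : ∀ n ∉ S, c n = 0) :
    eLpNorm (trigSum S c) ∞ (cubeMeasure d) ≤ eLpNorm c 1 Measure.count := by
  have h1 := eLpNorm_count_eq_sum hc one_pos
  rw [ENNReal.ofReal_one] at h1
  rw [h1, eLpNorm_exponent_top]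
  refine eLpNormEssSup_le_of_ae_bound (Filter.Eventually.of_forall fun x => ?_)
  simpa using norm_trigSum_le S c x

lemma eLpNorm_top_trigSum_le_mul {d : ℕ} {p : ℝ≥0∞} (hp : 1 < p) (γ : ℝ)
    {S : Finset (Fin d → ℤ)} {c : (Fin d → ℤ) → ℝ} (hc : ∀ n ∉ S, c n = 0) :
    eLpNorm (trigSum S c) ∞ (cubeMeasure d) ≤
      ENNReal.ofReal ((∑ n ∈ S, latticeWeight n ^ (-(γ / (1 - (1 / p).toReal)))) ^
        (1 - (1 / p).toReal)) *
        eLpNorm (fun n => c n * latticeWeight n ^ γ) p Measure.count := by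
  have hpinv : p⁻¹ < 1 := ENNReal.inv_lt_one.2 hp
  have ha := toReal_one_div_lt_one hp
  set a := (1 / p).toReal with hadef
  set e := 1 - a with he
  have he0 : 0 < e := by linarith
  have ha0 : 0 ≤ a := ENNReal.toReal_nonneg
  have hconj : ENNReal.HolderConjugate p (ENNReal.ofReal e⁻¹) := by
    rw [ENNReal.holderConjugate_iff, ← ENNReal.ofReal_inv_of_pos (by positivity), inv_inv,
      ← ENNReal.ofReal_toReal hpinv.ne_top, ← one_div, ← hadef, ← ENNReal.ofReal_add ha0 he0.le,
      he, add_sub_cancel, ENNReal.ofReal_one]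
  have hnorm := eLpNorm_count_eq_sum (S := S)
    (f := (S : Set (Fin d → ℤ)).indicator fun n => latticeWeight n ^ (-γ))
    (fun n hn => Set.indicator_of_notMem (by simpa using hn) _) (inv_pos.2 he0)
  have hsum : ∑ n ∈ S, |(S : Set (Fin d → ℤ)).indicator (fun n => latticeWeight n ^ (-γ)) n| ^ e⁻¹
      = ∑ n ∈ S, latticeWeight n ^ (-(γ / e)) := by
    refine Finset.sum_congr rfl fun n hn => ?_
    rw [Set.indicator_of_mem (by simpa using hn), abs_of_pos (latticeWeight_rpow_pos n _),
      ← Real.rpow_mul (latticeWeight_pos n).le, neg_mul, ← div_eq_mul_inv]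
  rw [hsum, one_div, inv_inv] at hnorm
  rw [← hnorm, mul_comm]
  refine (eLpNorm_top_trigSum_le hc).trans ?_
  have hmul := eLpNorm_smul_le_mul_eLpNorm (p := p) (q := ENNReal.ofReal e⁻¹) (r := 1)
    (μ := Measure.count)
    (f := (S : Set (Fin d → ℤ)).indicator fun n => latticeWeight n ^ (-γ))
    (φ := fun n => c n * latticeWeight n ^ γ)
    (measurable_of_countable _).aestronglyMeasurable
    (measurable_of_countable _).aestronglyMeasurable
  refine le_trans (le_of_eq ?_) hmul
  congr 1
  funext n
  by_cases hn : n ∈ S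
  · rw [Pi.smul_apply', Set.indicator_of_mem (by simpa using hn), smul_eq_mul, mul_assoc,
      ← Real.rpow_add (latticeWeight_pos n), add_neg_cancel, Real.rpow_zero, mul_one]
  · simp [hc n hn]

lemma trigConst_top_le_of_sum {d : ℕ} {p : ℝ≥0∞} (hp : 1 < p) {γ B : ℝ} {M : ℕ}
    (h : ∀ S : Finset (Fin d → ℤ), (∀ n ∈ S, zNorm n ≤ M) →
      ∑ n ∈ S, latticeWeight n ^ (-(γ / (1 - (1 / p).toReal))) ≤ B) :
    trigConst d γ ∞ p M ≤ ENNReal.ofReal (B ^ (1 - (1 / p).toReal)) := by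
  have ha := toReal_one_div_le_one hp.le
  refine trigConst_le fun S c hc hS => (eLpNorm_top_trigSum_le_mul hp γ hc).trans ?_
  gcongr
  · exact Finset.sum_nonneg fun n _ => (latticeWeight_rpow_pos n _).le
  · exact h S hS

/-! ### Lower bounds -/

lemma le_eLpNorm_trigSum {d : ℕ} (hd : 1 ≤ d) {M : ℕ} (hM : 1 ≤ M) {S : Finset (Fin d → ℤ)}
    {c : (Fin d → ℤ) → ℝ} (hc : ∀ n ∈ S, 0 ≤ c n) (hS : ∀ n ∈ S, zNorm n ≤ M)
    {q : ℝ≥0∞} (hq : q ≠ 0) :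
    ENNReal.ofReal ((∑ n ∈ S, c n) / 2 * ((1 / (2 * π * d * M)) ^ d) ^ (1 / q).toReal) ≤
      eLpNorm (trigSum S c) q (cubeMeasure d) := by
  have hd0 : (1 : ℝ) ≤ d := by exact_mod_cast hd
  have hM0 : (1 : ℝ) ≤ M := by exact_mod_cast hM
  have hπ := Real.pi_gt_three
  set δ : ℝ := 1 / (2 * π * d * M) with hδ
  have hδ0 : 0 < δ := by positivity
  have hδ1 : δ ≤ 1 := by
    rw [hδ, div_le_one (by positivity)]
    have h1 : (1 : ℝ) ≤ d * M := one_le_mul_of_one_le_of_one_le hd0 hM0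
    nlinarith
  set Q : Set (Fin d → ℝ) := Set.univ.pi fun _ => Set.Icc 0 δ with hQ
  have hQm : MeasurableSet Q := MeasurableSet.univ_pi fun _ => measurableSet_Icc
  have hQvol : volume Q = ENNReal.ofReal (δ ^ d) := by
    rw [hQ, volume_pi_pi]
    simp [ENNReal.ofReal_pow hδ0.le]
  have hsub : Q ⊆ Set.univ.pi fun _ : Fin d => Set.Icc (0 : ℝ) 1 :=
    Set.pi_mono fun _ _ => Set.Icc_subset_Icc_right hδ1
  have hcos : ∀ x ∈ Q, ∀ n ∈ S, 1 / 2 ≤ (latticeChar n x).re := by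
    intro x hx n hn
    rw [re_latticeChar]
    have hsum : |∑ i, x i * (n i : ℝ)| ≤ d * (δ * M) := by
      calc |∑ i, x i * (n i : ℝ)| ≤ ∑ i, |x i * (n i : ℝ)| := Finset.abs_sum_le_sum_abs _ _
        _ ≤ ∑ _i : Fin d, δ * M := by
            refine Finset.sum_le_sum fun i _ => ?_
            have hxi := hx i (Set.mem_univ i)
            rw [abs_mul, abs_of_nonneg hxi.1]
            exact mul_le_mul hxi.2 ((abs_le_zNorm n i).trans (hS n hn)) (abs_nonneg _) hδ0.le
        _ = d * (δ * M) := by simp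
    have hle : |2 * π * ∑ i, x i * (n i : ℝ)| ≤ 1 := by
      rw [abs_mul, abs_of_pos (by positivity : 0 < 2 * π)]
      calc 2 * π * |∑ i, x i * (n i : ℝ)| ≤ 2 * π * (d * (δ * M)) := by gcongr
        _ = 1 := by
            rw [hδ]
            field_simp
    have h2 := Real.one_sub_sq_div_two_le_cos (x := 2 * π * ∑ i, x i * (n i : ℝ))
    have h3 := (sq_le_one_iff_abs_le_one _).2 hle
    linarith
  have hT : ∀ x ∈ Q, (∑ n ∈ S, c n) / 2 ≤ ‖trigSum S c x‖ := by
    intro x hx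
    refine le_trans ?_ (Complex.re_le_norm _)
    rw [trigSum, Complex.re_sum, Finset.sum_div]
    refine Finset.sum_le_sum fun n hn => ?_
    rw [Complex.re_ofReal_mul, div_eq_mul_one_div]
    exact mul_le_mul_of_nonneg_left (hcos x hx n hn) (hc n hn)
  have hsum0 : 0 ≤ (∑ n ∈ S, c n) / 2 := div_nonneg (Finset.sum_nonneg hc) (by norm_num)
  have hne : (volume.restrict Q : Measure (Fin d → ℝ)) ≠ 0 := by
    intro h
    have := congrArg (fun μ : Measure (Fin d → ℝ) => μ Set.univ) h
    simp only [Measure.restrict_apply_univ, hQvol, Measure.coe_zero, Pi.zero_apply,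
      ENNReal.ofReal_eq_zero, not_le.2 (pow_pos hδ0 d)] at this
  calc ENNReal.ofReal ((∑ n ∈ S, c n) / 2 * (δ ^ d) ^ (1 / q).toReal)
      = eLpNorm (fun _ : Fin d → ℝ => (∑ n ∈ S, c n) / 2) q (volume.restrict Q) := by
        rw [eLpNorm_const _ hq hne, Measure.restrict_apply_univ, hQvol,
          Real.enorm_of_nonneg hsum0, ENNReal.ofReal_mul hsum0,
          ENNReal.ofReal_rpow_of_pos (by positivity), one_div, ENNReal.toReal_inv, ← one_div]
    _ ≤ eLpNorm (trigSum S c) q (volume.restrict Q) := by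
        refine eLpNorm_mono_ae ?_
        filter_upwards [ae_restrict_mem hQm] with x hx
        rw [Real.norm_of_nonneg hsum0]
        exact hT x hx
    _ ≤ eLpNorm (trigSum S c) q (cubeMeasure d) :=
        eLpNorm_mono_measure _ (Measure.restrict_mono hsub le_rfl)

lemma zNorm_zero {d : ℕ} : zNorm (0 : Fin d → ℤ) = 0 := by simp [zNorm]

lemma one_le_trigConst (d : ℕ) (γ : ℝ) {q p : ℝ≥0∞} (hq : q ≠ 0) (hp : p ≠ 0) (M : ℕ) :
    1 ≤ trigConst d γ q p M := by
  have hT : trigSum {0} (Pi.single (0 : Fin d → ℤ) (1 : ℝ)) = fun _ => 1 := by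
    funext x
    simp [trigSum, latticeChar]
  have hind : (fun n : Fin d → ℤ => (Pi.single (0 : Fin d → ℤ) (1 : ℝ) : (Fin d → ℤ) → ℝ) n *
      latticeWeight n ^ γ) = ({0} : Set (Fin d → ℤ)).indicator fun _ => (1 : ℝ) := by
    funext n
    by_cases hn : n = 0
    · simp [hn, latticeWeight, zNorm_zero]
    · simp [hn]
  rw [← ENNReal.ofReal_one]
  refine le_trigConst (S := {0}) (c := Pi.single (0 : Fin d → ℤ) 1) (B := 1) ?_ ?_ ?_ one_pos ?_ ?_
  · simp
  · intro n hn
    exact Pi.single_eq_of_ne (by simpa using hn) _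
  · simp [zNorm_zero]
  · rw [hind, eLpNorm_indicator_const' (MeasurableSet.singleton _) (by simp) hp]
    simp
  · rw [hT, eLpNorm_const _ hq (IsProbabilityMeasure.ne_zero _)]
    simp

/-- The box `{0, …, m}^d`. -/
noncomputable def latticeBox (d m : ℕ) : Finset (Fin d → ℤ) := Fintype.piFinset fun _ => Finset.Icc (0 : ℤ) m

lemma zNorm_le_of_mem_latticeBox {d m : ℕ} {n : Fin d → ℤ} (hn : n ∈ latticeBox d m) :
    zNorm n ≤ d * m := by
  rw [latticeBox, Fintype.mem_piFinset] at hn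
  refine Real.sqrt_le_iff.2 ⟨by positivity, ?_⟩
  calc ∑ i, (n i : ℝ) ^ 2 ≤ ∑ _i : Fin d, (m : ℝ) ^ 2 := by
        refine Finset.sum_le_sum fun i _ => ?_
        have hi := Finset.mem_Icc.1 (hn i)
        have h1 : (0 : ℝ) ≤ n i := by exact_mod_cast hi.1
        have h2 : (n i : ℝ) ≤ m := by exact_mod_cast hi.2
        gcongr
    _ = d * (m : ℝ) ^ 2 := by simp
    _ ≤ (d * m : ℝ) ^ 2 := by
        rw [mul_pow]
        gcongr
        exact_mod_cast Nat.le_self_pow two_ne_zero d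

lemma card_latticeBox (d m : ℕ) : (latticeBox d m).card = (m + 1) ^ d := by
  rw [latticeBox, Fintype.card_piFinset_const, Int.card_Icc]
  congr 1

lemma zero_mem_latticeBox (d m : ℕ) : 0 ∈ latticeBox d m := by
  simp [latticeBox, Fintype.mem_piFinset]

lemma zNorm_le_of_mem_latticeBox_div {d M : ℕ} {n : Fin d → ℤ} (hn : n ∈ latticeBox d (M / d)) :
    zNorm n ≤ M :=
  (zNorm_le_of_mem_latticeBox hn).trans (by exact_mod_cast Nat.mul_div_le M d)

lemma exists_rpow_le_trigConst {d : ℕ} (hd : 1 ≤ d) {γ : ℝ} (hγ : 0 ≤ γ) {p q : ℝ≥0∞}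
    (hp : 1 ≤ p) (hq : q ≠ 0) :
    ∃ c : ℝ, 0 < c ∧ ∀ M : ℕ, 1 ≤ M → ENNReal.ofReal
      (c * (M : ℝ) ^ (-γ + d * (1 - (1 / p).toReal - (1 / q).toReal))) ≤ trigConst d γ q p M := by
  have hd0 : (0 : ℝ) < d := by exact_mod_cast hd
  have hp0 : p ≠ 0 := (zero_lt_one.trans_le hp).ne'
  have ha0 : 0 ≤ (1 / p).toReal := ENNReal.toReal_nonneg
  have ha1 := toReal_one_div_le_one hp
  set a := (1 / p).toReal with ha
  set b := (1 / q).toReal with hb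
  obtain ⟨K, hK⟩ : ∃ K, K = ((1 / (d : ℝ)) ^ d) ^ (1 - a) := ⟨_, rfl⟩
  obtain ⟨L, hL⟩ : ∃ L, L = ((1 / (2 * π * d : ℝ)) ^ d) ^ b := ⟨_, rfl⟩
  have hK0 : 0 < K := by rw [hK]; positivity
  have hL0 : 0 < L := by rw [hL]; positivity
  refine ⟨K * L / (2 * 2 ^ γ), by positivity, fun M hM => ?_⟩
  have hM0 : (0 : ℝ) < M := by exact_mod_cast hM
  have hM1 : (1 : ℝ) ≤ M := by exact_mod_cast hM
  set S := latticeBox d (M / d) with hS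
  set s : ℝ := (S.card : ℝ) with hs
  have hst : (1 / (d : ℝ)) ^ d * (M : ℝ) ^ d ≤ s := by
    rw [hs, hS, card_latticeBox, ← mul_pow]
    push_cast
    gcongr
    rw [one_div_mul_eq_div, div_le_iff₀ hd0]
    exact_mod_cast (Nat.lt_mul_of_div_lt (Nat.lt_succ_self (M / d)) hd).le
  have hs0 : 0 < s := lt_of_lt_of_le (by positivity) hst
  have hpow : ∀ t : ℝ, ((M : ℝ) ^ d) ^ t = (M : ℝ) ^ (d * t) := fun t => by
    rw [← Real.rpow_natCast, ← Real.rpow_mul hM0.le]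
  have hKs : K * (M : ℝ) ^ (d * (1 - a)) ≤ s ^ (1 - a) := by
    rw [hK, ← hpow, ← Real.mul_rpow (by positivity) (by positivity)]
    exact Real.rpow_le_rpow (by positivity) hst (by linarith)
  have hδ : ((1 / (2 * π * d * M)) ^ d) ^ b = L * (M : ℝ) ^ (-(d * b)) := by
    rw [hL, Real.rpow_neg hM0.le, ← hpow, ← Real.inv_rpow (by positivity),
      ← Real.mul_rpow (by positivity) (by positivity), ← inv_pow, ← mul_pow]
    congr 2
    field_simp
  have hM' : (M : ℝ) ^ (-γ + d * (1 - a - b)) * (M : ℝ) ^ γ =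
      (M : ℝ) ^ (d * (1 - a)) * (M : ℝ) ^ (-(d * b)) := by
    rw [← Real.rpow_add hM0, ← Real.rpow_add hM0]
    congr 1
    ring
  have hss : s ^ (1 - a) * s ^ a = s := by
    rw [← Real.rpow_add hs0, sub_add_cancel, Real.rpow_one]
  have hSM : ∀ n ∈ S, zNorm n ≤ M := fun n hn => zNorm_le_of_mem_latticeBox_div hn
  refine le_trigConst (S := S) (c := (S : Set (Fin d → ℤ)).indicator fun _ => 1)
    (B := (2 * M) ^ γ * s ^ a) ?_ ?_ hSM (by positivity) ?_ ?_
  · intro h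
    have := congrFun h 0
    rw [Set.indicator_of_mem (by simpa using zero_mem_latticeBox d (M / d))] at this
    simp at this
  · exact fun n hn => Set.indicator_of_notMem (by simpa using hn) _
  · calc eLpNorm (fun n => (S : Set (Fin d → ℤ)).indicator (fun _ => (1 : ℝ)) n *
          latticeWeight n ^ γ) p Measure.count
        ≤ eLpNorm ((S : Set (Fin d → ℤ)).indicator fun _ => (2 * M : ℝ) ^ γ) p Measure.count := by
          refine eLpNorm_mono fun n => ?_
          by_cases hn : n ∈ S
          · rw [Set.indicator_of_mem (by simpa using hn), Set.indicator_of_mem (by simpa using hn),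
              one_mul, Real.norm_of_nonneg (latticeWeight_rpow_pos n γ).le,
              Real.norm_of_nonneg (by positivity)]
            have := hSM n hn
            refine Real.rpow_le_rpow (latticeWeight_pos n).le ?_ hγ
            unfold latticeWeight
            linarith
          · simp [hn]
      _ = ENNReal.ofReal ((2 * M) ^ γ * s ^ a) := by
          rw [eLpNorm_indicator_const' S.measurableSet _ hp0, Measure.count_apply_finset,
            Real.enorm_of_nonneg (by positivity), ENNReal.ofReal_mul (by positivity),
            ← ENNReal.ofReal_rpow_of_pos hs0, hs, ENNReal.ofReal_natCast, ha, one_div p,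
            ENNReal.toReal_inv, one_div]
          rw [Measure.count_apply_finset]
          exact_mod_cast Finset.card_ne_zero_of_mem (zero_mem_latticeBox d (M / d))
  · refine le_trans (ENNReal.ofReal_le_ofReal ?_) (le_eLpNorm_trigSum hd hM ?_ hSM hq)
    · rw [Finset.sum_congr rfl fun n hn =>
        Set.indicator_of_mem (s := (S : Set (Fin d → ℤ))) (by simpa using hn) _,
        Finset.sum_const, nsmul_eq_mul, mul_one, ← hs, ← hb, hδ, Real.mul_rpow (by norm_num) hM0.le]
      calc K * L / (2 * 2 ^ γ) * (M : ℝ) ^ (-γ + d * (1 - a - b)) * (2 ^ γ * (M : ℝ) ^ γ * s ^ a)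
          = K * L / 2 * ((M : ℝ) ^ (-γ + d * (1 - a - b)) * (M : ℝ) ^ γ) * s ^ a := by
            field_simp
        _ = (K * (M : ℝ) ^ (d * (1 - a))) * s ^ a / 2 * (L * (M : ℝ) ^ (-(d * b))) := by
            rw [hM']
            ring
        _ ≤ s ^ (1 - a) * s ^ a / 2 * (L * (M : ℝ) ^ (-(d * b))) := by gcongr
        _ = s / 2 * (L * (M : ℝ) ^ (-(d * b))) := by rw [hss]
    · intro n hn
      rw [Set.indicator_of_mem (by simpa using hn)]
      exact zero_le_one

lemma latticeBox_subset_succ (d m : ℕ) : latticeBox d m ⊆ latticeBox d (m + 1) :=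
  Fintype.piFinset_subset _ _ fun _ => Finset.Icc_subset_Icc_right (by simp)

lemma log_le_sum_latticeBox {d : ℕ} (hd : 1 ≤ d) (m : ℕ) :
    ((d : ℝ) ^ d)⁻¹ * Real.log (m + 2) ≤
      ∑ n ∈ latticeBox d m, latticeWeight n ^ (-(d : ℝ)) := by
  have hd0 : (1 : ℝ) ≤ d := by exact_mod_cast hd
  induction m with
  | zero =>
    have h1 : (latticeWeight (0 : Fin d → ℤ)) ^ (-(d : ℝ)) ≤
        ∑ n ∈ latticeBox d 0, latticeWeight n ^ (-(d : ℝ)) :=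
      Finset.single_le_sum (f := fun n => latticeWeight n ^ (-(d : ℝ)))
        (fun n _ => (latticeWeight_rpow_pos n _).le) (zero_mem_latticeBox d 0)
    have h2 : latticeWeight (0 : Fin d → ℤ) = 1 := by simp [latticeWeight, zNorm_zero]
    rw [h2, Real.one_rpow] at h1
    refine le_trans ?_ h1
    have h3 : Real.log ((0 : ℕ) + 2) ≤ 1 := by
      rw [Nat.cast_zero, zero_add]
      linarith [Real.log_two_lt_d9]
    exact mul_le_one₀ (inv_le_one_of_one_le₀ (one_le_pow₀ hd0)) (Real.log_nonneg (by simp)) h3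
  | succ m ih =>
    have hterm : ∀ n ∈ latticeBox d (m + 1) \ latticeBox d m,
        ((d * (m + 2) : ℝ) ^ d)⁻¹ ≤ latticeWeight n ^ (-(d : ℝ)) := by
      intro n hn
      have hz := zNorm_le_of_mem_latticeBox (Finset.mem_sdiff.1 hn).1
      push_cast at hz
      rw [Real.rpow_neg (latticeWeight_pos n).le, Real.rpow_natCast]
      have hw := latticeWeight_pos n
      gcongr
      unfold latticeWeight
      linarith
    have hcard : ((m + 2 : ℝ)) ^ (d - 1) ≤ ((latticeBox d (m + 1) \ latticeBox d m).card : ℝ) := by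
      rw [Finset.cast_card_sdiff (latticeBox_subset_succ d m), card_latticeBox, card_latticeBox]
      obtain ⟨e, rfl⟩ := Nat.exists_eq_add_of_le' hd
      rw [Nat.add_sub_cancel]
      push_cast
      have h1 : ((m : ℝ) + 1) ^ e ≤ ((m : ℝ) + 2) ^ e := by gcongr; norm_num
      have h2 : ((m : ℝ) + 1) ^ e * (m + 1) ≤ ((m : ℝ) + 2) ^ e * (m + 1) := by gcongr
      rw [add_assoc, one_add_one_eq_two, pow_succ, pow_succ]
      linarith
    have hnew : ((d : ℝ) ^ d)⁻¹ * (1 / (m + 2)) ≤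
        ∑ n ∈ latticeBox d (m + 1) \ latticeBox d m, latticeWeight n ^ (-(d : ℝ)) := by
      calc ((d : ℝ) ^ d)⁻¹ * (1 / (m + 2))
          = (m + 2 : ℝ) ^ (d - 1) * ((d * (m + 2) : ℝ) ^ d)⁻¹ := by
            obtain ⟨e, rfl⟩ := Nat.exists_eq_add_of_le' hd
            rw [Nat.add_sub_cancel, mul_pow, pow_succ ((m : ℝ) + 2)]
            field_simp
        _ ≤ ((latticeBox d (m + 1) \ latticeBox d m).card : ℝ) * ((d * (m + 2) : ℝ) ^ d)⁻¹ := by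
            gcongr
        _ ≤ _ := by
            rw [← nsmul_eq_mul]
            exact Finset.card_nsmul_le_sum _ _ _ hterm
    have hlog : Real.log ((m + 1 : ℕ) + 2) ≤ Real.log (m + 2) + 1 / (m + 2) := by
      have h1 := Real.log_le_sub_one_of_pos
        (by positivity : (0 : ℝ) < ((m + 1 : ℕ) + 2) / (m + 2))
      rw [Real.log_div (by positivity) (by positivity)] at h1
      have h2 : (((m + 1 : ℕ) : ℝ) + 2) / (m + 2) - 1 = 1 / (m + 2) := by
        push_cast
        field_simp
        ring
      linarith
    rw [← Finset.sum_sdiff (latticeBox_subset_succ d m)]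
    calc _ ≤ ((d : ℝ) ^ d)⁻¹ * (Real.log (m + 2) + 1 / (m + 2)) := by gcongr
      _ ≤ _ := by
        rw [mul_add, add_comm]
        exact add_le_add hnew ih

lemma exists_log_le_sum_latticeBox {d : ℕ} (hd : 1 ≤ d) :
    ∃ c : ℝ, 0 < c ∧ ∀ M : ℕ, 1 ≤ M → c * Real.log ((M : ℝ) + 1) ≤
      ∑ n ∈ latticeBox d (M / d), latticeWeight n ^ (-(d : ℝ)) := by
  have hd0 : (0 : ℝ) < d := by exact_mod_cast hd
  refine ⟨((d : ℝ) ^ d)⁻¹ / (d + 1), by positivity, fun M hM => ?_⟩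
  refine le_trans ?_ (log_le_sum_latticeBox hd (M / d))
  have h1 : M + 1 ≤ (M / d + 2) ^ (d + 1) := by
    have h2 : M < d * (M / d + 1) := Nat.lt_mul_div_succ M hd
    have h3 : d ≤ (M / d + 2) ^ d :=
      (Nat.lt_two_pow_self).le.trans (Nat.pow_le_pow_left (Nat.le_add_left 2 _) d)
    calc M + 1 ≤ d * (M / d + 1) := h2
      _ ≤ (M / d + 2) ^ d * (M / d + 2) := Nat.mul_le_mul h3 (Nat.le_succ _)
      _ = _ := (pow_succ _ _).symm
  have h4 : Real.log ((M : ℝ) + 1) ≤ (d + 1) * Real.log (((M / d : ℕ) : ℝ) + 2) := by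
    have h5 : ((M : ℝ) + 1) ≤ (((M / d : ℕ) : ℝ) + 2) ^ (d + 1) := by exact_mod_cast h1
    calc _ ≤ Real.log ((((M / d : ℕ) : ℝ) + 2) ^ (d + 1)) := Real.log_le_log (by positivity) h5
      _ = _ := by
        rw [Real.log_pow]
        push_cast
        ring
  calc ((d : ℝ) ^ d)⁻¹ / (d + 1) * Real.log ((M : ℝ) + 1)
      ≤ ((d : ℝ) ^ d)⁻¹ / (d + 1) * ((d + 1) * Real.log (((M / d : ℕ) : ℝ) + 2)) := by gcongr
    _ = _ := by field_simp

lemma exists_log_le_trigConst {d : ℕ} (hd : 1 ≤ d) {γ : ℝ} {p : ℝ≥0∞} (hp : 1 ≤ p)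
    (hγ : γ = d * (1 - (1 / p).toReal)) :
    ∃ c : ℝ, 0 < c ∧ ∀ M : ℕ, 1 ≤ M → ENNReal.ofReal
      (c * Real.log ((M : ℝ) + 1) ^ (1 - (1 / p).toReal)) ≤ trigConst d γ ∞ p M := by
  obtain ⟨k, hk, hlog⟩ := exists_log_le_sum_latticeBox hd
  have ha0 : 0 ≤ (1 / p).toReal := ENNReal.toReal_nonneg
  have ha1 := toReal_one_div_le_one hp
  set a := (1 / p).toReal with ha
  refine ⟨k ^ (1 - a) / 2, by positivity, fun M hM => ?_⟩
  have hM1 : (1 : ℝ) ≤ M := by exact_mod_cast hM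
  set S := latticeBox d (M / d) with hS
  set H := ∑ n ∈ S, latticeWeight n ^ (-(d : ℝ)) with hH
  have hlog0 : 0 < Real.log ((M : ℝ) + 1) := Real.log_pos (by linarith)
  have hH0 : 0 < H := lt_of_lt_of_le (by positivity) (hlog M hM)
  set c : (Fin d → ℤ) → ℝ := (S : Set (Fin d → ℤ)).indicator fun n => latticeWeight n ^ (-(d : ℝ))
    with hc
  have hcS : ∀ n ∈ S, c n = latticeWeight n ^ (-(d : ℝ)) := fun n hn =>
    Set.indicator_of_mem (by simpa using hn) _
  have hcS' : ∀ n ∉ S, c n = 0 := fun n hn => Set.indicator_of_notMem (by simpa using hn) _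
  have hcw : ∀ n ∈ S, c n * latticeWeight n ^ γ = latticeWeight n ^ (-(d * a)) := fun n hn => by
    rw [hcS n hn, ← Real.rpow_add (latticeWeight_pos n), hγ]
    congr 1
    ring
  have hSM : ∀ n ∈ S, zNorm n ≤ M := fun n hn => zNorm_le_of_mem_latticeBox_div hn
  refine le_trigConst (S := S) (c := c) (B := H ^ a) ?_ hcS' hSM (by positivity) ?_ ?_
  · intro h
    have h0 := hcS 0 (zero_mem_latticeBox d (M / d))
    rw [h] at h0
    exact (latticeWeight_rpow_pos _ _).ne h0
  · rcases eq_or_ne p ∞ with rfl | hpt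
    · have haz : a = 0 := by simp [ha]
      rw [eLpNorm_exponent_top]
      refine eLpNormEssSup_le_of_ae_bound (Filter.Eventually.of_forall fun n => ?_)
      by_cases hn : n ∈ S
      · simp [hcw n hn, haz]
      · simp [hcS' n hn, haz]
    · have hr : 0 < p.toReal := ENNReal.toReal_pos (zero_lt_one.trans_le hp).ne' hpt
      have har : a = 1 / p.toReal := by rw [ha, one_div, ENNReal.toReal_inv, one_div]
      have h1 := eLpNorm_count_eq_sum (S := S) (f := fun n => c n * latticeWeight n ^ γ)
        (fun n hn => by rw [hcS' n hn, zero_mul]) hr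
      rw [ENNReal.ofReal_toReal hpt] at h1
      refine (h1.trans ?_).le
      rw [← har, hH]
      congr 2
      refine Finset.sum_congr rfl fun n hn => ?_
      rw [hcw n hn, abs_of_pos (latticeWeight_rpow_pos n _),
        ← Real.rpow_mul (latticeWeight_pos n).le, har]
      congr 1
      field_simp
  · refine le_trans (ENNReal.ofReal_le_ofReal ?_) (le_eLpNorm_trigSum hd hM ?_ hSM
      ENNReal.top_ne_zero)
    · rw [Finset.sum_congr rfl hcS, ← hH]
      simp only [one_div, ENNReal.inv_top, ENNReal.toReal_zero, Real.rpow_zero, mul_one]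
      calc k ^ (1 - a) / 2 * Real.log ((M : ℝ) + 1) ^ (1 - a) * H ^ a
          = (k * Real.log ((M : ℝ) + 1)) ^ (1 - a) * H ^ a / 2 := by
            rw [Real.mul_rpow hk.le hlog0.le]
            ring
        _ ≤ H ^ (1 - a) * H ^ a / 2 := by
            gcongr
            exact hlog M hM
        _ = H / 2 := by rw [← Real.rpow_add hH0, sub_add_cancel, Real.rpow_one]
    · intro n hn
      rw [hcS n hn]
      exact (latticeWeight_rpow_pos n _).le

/-! ### Upper bounds for the supremum norm -/

lemma trigConst_top_one_le {d : ℕ} {γ : ℝ} (hγ : 0 ≤ γ) (M : ℕ) : trigConst d γ ∞ 1 M ≤ 1 := by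
  refine trigConst_le fun S c hc _ => (eLpNorm_top_trigSum_le hc).trans ?_
  simpa using eLpNorm_mul_latticeWeight_mono c hγ 1

lemma exists_trigConst_top_le_rpow {d : ℕ} {γ : ℝ} (hγ : 0 ≤ γ) {p : ℝ≥0∞} (hp : 1 < p)
    (hγd : γ < d * (1 - (1 / p).toReal)) :
    ∃ C : ℝ, 0 < C ∧ ∀ M : ℕ, 1 ≤ M → trigConst d γ ∞ p M ≤
      ENNReal.ofReal (C * (M : ℝ) ^ (-γ + d * (1 - (1 / p).toReal))) := by
  have he0 : 0 < 1 - (1 / p).toReal := sub_pos.2 (toReal_one_div_lt_one hp)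
  set e := 1 - (1 / p).toReal with he
  have hs : γ / e < d := (div_lt_iff₀ he0).2 hγd
  obtain ⟨A, hA, h⟩ := exists_sum_rpow_low_le (d := d) (div_nonneg hγ he0.le) hs
  refine ⟨A ^ e * (2 ^ (d - γ / e)) ^ e, by positivity, fun M hM => ?_⟩
  have hM1 : (1 : ℝ) ≤ M := by exact_mod_cast hM
  refine (trigConst_top_le_of_sum hp (B := A * (2 * M) ^ (d - γ / e)) fun S hS =>
    h (2 * M) (by positivity) S fun n hn => ?_).trans_eq ?_
  · have := hS n hn
    unfold latticeWeight
    linarith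
  · rw [← he, Real.mul_rpow hA.le (by positivity), Real.mul_rpow (by norm_num) (by positivity),
      Real.mul_rpow (by positivity) (by positivity), ← mul_assoc,
      ← Real.rpow_mul (by positivity : (0 : ℝ) ≤ M)]
    congr 3
    field_simp
    ring

lemma exists_trigConst_top_le_log {d : ℕ} {γ : ℝ} {p : ℝ≥0∞} (hp : 1 < p)
    (hγd : γ = d * (1 - (1 / p).toReal)) :
    ∃ C : ℝ, 0 < C ∧ ∀ M : ℕ, 1 ≤ M → trigConst d γ ∞ p M ≤
      ENNReal.ofReal (C * Real.log ((M : ℝ) + 1) ^ (1 - (1 / p).toReal)) := by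
  have he0 : 0 < 1 - (1 / p).toReal := sub_pos.2 (toReal_one_div_lt_one hp)
  have hs : γ / (1 - (1 / p).toReal) = d := by rw [hγd, mul_div_cancel_right₀ _ he0.ne']
  obtain ⟨A, hA, h⟩ := exists_sum_rpow_critical_le d
  refine ⟨A ^ (1 - (1 / p).toReal), by positivity, fun M hM => ?_⟩
  have hlog0 : 0 ≤ Real.log ((M : ℝ) + 1) := Real.log_nonneg (by simp)
  rw [← Real.mul_rpow hA.le hlog0]
  exact trigConst_top_le_of_sum hp fun S hS => by
    rw [hs]
    exact h M hM S hS

lemma exists_trigConst_top_le {d : ℕ} {γ : ℝ} {p : ℝ≥0∞} (hp : 1 < p)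
    (hγd : d * (1 - (1 / p).toReal) < γ) :
    ∃ C : ℝ, 0 < C ∧ ∀ M : ℕ, trigConst d γ ∞ p M ≤ ENNReal.ofReal C := by
  have he0 : 0 < 1 - (1 / p).toReal := sub_pos.2 (toReal_one_div_lt_one hp)
  have hs : d < γ / (1 - (1 / p).toReal) := (lt_div_iff₀ he0).2 hγd
  obtain ⟨A, hA, h⟩ := exists_sum_rpow_tail_le hs
  refine ⟨A ^ (1 - (1 / p).toReal), by positivity, fun M => ?_⟩
  exact trigConst_top_le_of_sum hp fun S _ => by
    simpa using h 1 le_rfl S fun n _ => one_le_latticeWeight n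

/-- Lemma 2.2, items (1) and (2): behaviour of `C_{q,p}(M)` for `1 ≤ p ≤ q ≤ ∞`. -/
theorem trigConst_asymptotics_p_le_q
    (d : ℕ) (hd : 1 ≤ d) (γ : ℝ) (hγ : 0 ≤ γ) (p q : ℝ≥0∞) (hp : 1 ≤ p) (hpq : p ≤ q) :
    ∃ c C : ℝ, 0 < c ∧ 0 < C ∧ ∀ M : ℕ, 1 ≤ M →
      ((q ≠ ∞ →
          (γ < (d : ℝ) * (1 - (1/p).toReal - (1/q).toReal) →
            Approx (trigConst d γ q p M) c C
              ((M : ℝ) ^ (-γ + (d : ℝ) * (1 - (1/p).toReal - (1/q).toReal)))) ∧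
          ((d : ℝ) * (1 - (1/p).toReal - (1/q).toReal) ≤ γ →
            Approx (trigConst d γ q p M) c C 1)) ∧
        (q = ∞ →
          (γ < (d : ℝ) * (1 - (1/p).toReal) →
            Approx (trigConst d γ q p M) c C
              ((M : ℝ) ^ (-γ + (d : ℝ) * (1 - (1/p).toReal)))) ∧
          (γ = (d : ℝ) * (1 - (1/p).toReal) →
            Approx (trigConst d γ q p M) c C
              (Real.log ((M : ℝ) + 1) ^ (1 - (1/p).toReal))) ∧
          ((d : ℝ) * (1 - (1/p).toReal) < γ →
            Approx (trigConst d γ q p M) c C 1))) := by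
  have hp0 : p ≠ 0 := (zero_lt_one.trans_le hp).ne'
  have hq0 : q ≠ 0 := (zero_lt_one.trans_le (hp.trans hpq)).ne'
  have hone : ∀ M, ENNReal.ofReal (1 * 1) ≤ trigConst d γ q p M := fun M => by
    simpa using one_le_trigConst d γ hq0 hp0 M
  rcases eq_or_ne q ∞ with rfl | hq
  · rcases hp.eq_or_lt with rfl | hp1
    · have hC : ∀ M, trigConst d γ ∞ 1 M ≤ ENNReal.ofReal (1 * 1) := fun M => by
        simpa using trigConst_top_one_le hγ M
      refine ⟨1, 1, one_pos, one_pos, fun M _ => ⟨fun h => absurd rfl h, fun _ =>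
        ⟨fun h => ?_, fun _ => ?_, fun _ => ⟨hone M, hC M⟩⟩⟩⟩
      · simp only [div_one, ENNReal.toReal_one, sub_self, mul_zero] at h
        linarith
      · have hexp : 1 - (1 / (1 : ℝ≥0∞)).toReal = 0 := by simp
        rw [hexp, Real.rpow_zero]
        exact ⟨hone M, hC M⟩
    rcases lt_trichotomy γ (d * (1 - (1 / p).toReal)) with h | h | h
    · obtain ⟨c, hc, hlow⟩ := exists_rpow_le_trigConst hd hγ hp hq0
      obtain ⟨C, hC, hup⟩ := exists_trigConst_top_le_rpow hγ hp1 h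
      refine ⟨c, C, hc, hC, fun M hM => ⟨fun h' => absurd rfl h', fun _ =>
        ⟨fun _ => ⟨?_, hup M hM⟩, fun h' => absurd h' h.ne, fun h' => absurd h' h.not_gt⟩⟩⟩
      simpa using hlow M hM
    · obtain ⟨c, hc, hlow⟩ := exists_log_le_trigConst hd hp h
      obtain ⟨C, hC, hup⟩ := exists_trigConst_top_le_log hp1 h
      exact ⟨c, C, hc, hC, fun M hM => ⟨fun h' => absurd rfl h', fun _ =>
        ⟨fun h' => absurd h h'.ne, fun _ => ⟨hlow M hM, hup M hM⟩, fun h' => absurd h h'.ne'⟩⟩⟩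
    · obtain ⟨C, hC, hup⟩ := exists_trigConst_top_le hp1 h
      exact ⟨1, C, one_pos, hC, fun M _ => ⟨fun h' => absurd rfl h', fun _ =>
        ⟨fun h' => absurd h' h.not_gt, fun h' => absurd h' h.ne',
          fun _ => ⟨hone M, by simpa using hup M⟩⟩⟩⟩
  have hpt : p ≠ ∞ := ne_top_of_le_ne_top hq hpq
  have hinv : ∀ r : ℝ≥0∞, (1 / r).toReal = 1 / r.toReal := fun r => by simp
  obtain ⟨C, hC, hup⟩ := exists_eLpNorm_trigSum_le hd
    (by simpa using ENNReal.toReal_mono hpt hp) (ENNReal.toReal_mono hq hpq)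
  rw [ENNReal.ofReal_toReal hpt, ENNReal.ofReal_toReal hq, ← hinv, ← hinv] at hup
  rcases lt_or_ge γ (d * (1 - (1 / p).toReal - (1 / q).toReal)) with h | h
  · obtain ⟨c, hc, hlow⟩ := exists_rpow_le_trigConst hd hγ hp hq0
    rw [max_eq_left (hγ.trans h.le)] at hup
    refine ⟨c, C * 2 ^ (d * (1 - (1 / p).toReal - (1 / q).toReal) - γ), hc, by positivity,
      fun M hM => ⟨fun _ => ⟨fun _ => ⟨hlow M hM, ?_⟩, fun h' => absurd h h'.not_gt⟩,
        fun h' => absurd h' hq⟩⟩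
    rw [neg_add_eq_sub]
    exact trigConst_le_of_rpow hC h.le hup hM
  · refine ⟨1, C, one_pos, hC, fun M hM => ⟨fun _ => ⟨fun h' => absurd h h'.not_ge,
      fun _ => ⟨hone M, ?_⟩⟩, fun h' => absurd h' hq⟩⟩
    simpa using trigConst_le_of_rpow (γ := γ) hC le_rfl
      (fun S c hc => (hup S c hc).trans (mul_le_mul_right
        (eLpNorm_mul_latticeWeight_mono c (max_le h hγ) p) _)) hM
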